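/- Let F be a field of characteristic 2 and let q be an Albert form over F which represents 1. Let F(q) be the function field of the projective quadric defined by q, and let q₁ be a quadratic form over F(q) such that q_{F(q)} ≅ q₁ ⊥ ℍ, where ℍ is the hyperbolic plane. If q₁ represents 1, then q is isotropic over F. -/

import Mathlib

/-!
Shared definitions: quadratic form theory in characteristic 2.
-/

namespace Char2Quadrics

open QuadraticMap

noncomputable section

variable (F : Type) [Field F]

/-- The binary quadratic form `[1,b] = ⟨⟨b]]`, i.e. `(x, y) ↦ x² + xy + b·y²`. -/
def binForm (b : F) : QuadraticForm F (F × F) :=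
  linMulLin (LinearMap.fst F F F) (LinearMap.fst F F F)
    + linMulLin (LinearMap.fst F F F) (LinearMap.snd F F F)
    + b • linMulLin (LinearMap.snd F F F) (LinearMap.snd F F F)

/-- The hyperbolic plane `ℍ : (x, y) ↦ xy`. -/
def hyperbolicPlane : QuadraticForm F (F × F) :=
  linMulLin (LinearMap.fst F F F) (LinearMap.snd F F F)

/-- The orthogonal sum `⊥ᵢ aᵢ·[1, bᵢ]` of scaled binary forms. -/
def sumBin {ι : Type} [Fintype ι] (a b : ι → F) : QuadraticForm F (ι → F × F) :=
  ∑ i, a i • (binForm F (b i)).comp (LinearMap.proj i)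

/-- The quadratic `(k+1)`-Pfister form `⟨⟨a₁, …, a_k ; c]]`, realized via its
orthogonal decomposition `⊥_{S ⊆ {1,…,k}} (∏_{i ∈ S} aᵢ)·[1, c]`. -/
def pfisterForm {k : ℕ} (a : Fin k → F) (c : F) :
    QuadraticForm F (Finset (Fin k) → F × F) :=
  sumBin F (fun S => ∏ i ∈ S, a i) (fun _ => c)

/-- The ternary conic form `⟨a⟩ ⊥ [1, b]`, whose zero set in `ℙ²` is the conic
associated to the quaternion algebra `(a, b]`. -/
def conicForm (a b : F) : QuadraticForm F (F × (F × F)) :=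
  a • linMulLin (LinearMap.fst F F (F × F)) (LinearMap.fst F F (F × F))
    + (binForm F b).comp (LinearMap.snd F F (F × F))

variable {F}
variable {V : Type} [AddCommGroup V] [Module F V]
variable {W : Type} [AddCommGroup W] [Module F W]

/-- `ψ` is a subform of `φ`. -/
def IsSubform (ψ : QuadraticForm F W) (φ : QuadraticForm F V) : Prop :=
  ∃ f : W →ₗ[F] V, Function.Injective f ∧ ∀ w, φ (f w) = ψ w

/-- `φ` is a (quadratic) `n`-Pfister form (`n ≥ 1`). -/
def IsPfister (n : ℕ) (φ : QuadraticForm F V) : Prop :=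
  ∃ (a : Fin (n - 1) → F) (c : F), (∀ i, a i ≠ 0) ∧
    QuadraticMap.Equivalent φ (pfisterForm F a c)

/-- `φ` is a neighbor of the general `(k+1)`-Pfister form `d·⟨⟨a₁,…,a_k ; c]]`:
it is a subform of it of dimension `> 2^k`. -/
def IsPfisterNeighborOf {k : ℕ} (φ : QuadraticForm F V) (d : F) (a : Fin k → F) (c : F) :
    Prop :=
  d ≠ 0 ∧ (∀ i, a i ≠ 0) ∧ IsSubform φ (d • pfisterForm F a c) ∧
    2 ^ k < Module.finrank F V

/-- `φ` is a Pfister neighbor (of an `n`-Pfister form for some `n ≥ 2`). -/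
def IsPfisterNeighbor (φ : QuadraticForm F V) : Prop :=
  ∃ (k : ℕ), 1 ≤ k ∧ ∃ (d : F) (a : Fin k → F) (c : F), IsPfisterNeighborOf φ d a c

/-- `φ` is nondegenerate: the restriction of `φ` to the radical of its polar form is
anisotropic, and this radical has dimension at most 1 (this is the characteristic-2
notion of nondegeneracy, equivalent to smoothness of the projective quadric `X_φ`). -/
def IsNondegenerate (φ : QuadraticForm F V) : Prop :=
  (∀ v : V, (∀ w : V, polar φ v w = 0) → φ v = 0 → v = 0) ∧
    Module.finrank F (LinearMap.ker (polarBilin φ)) ≤ 1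

/-- `φ` (a nondegenerate form of even dimension) has trivial Arf invariant
`e₁(φ) = 0 ∈ H¹(F, ℤ/2) = F/℘(F)`: in some (equivalently, any) decomposition
`φ ≅ ⊥ᵢ aᵢ[1, bᵢ]` the sum `∑ᵢ bᵢ` lies in `℘(F) = {x² - x | x ∈ F}`. -/
def HasTrivialArf (φ : QuadraticForm F V) : Prop :=
  ∃ (m : ℕ) (a b : Fin m → F), (∀ i, a i ≠ 0) ∧
    QuadraticMap.Equivalent φ (sumBin F a b) ∧ ∃ x : F, ∑ i, b i = x ^ 2 - x

/-- `φ` is an Albert form: a 6-dimensional nondegenerate quadratic form with trivial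
Arf invariant. -/
def IsAlbert (φ : QuadraticForm F V) : Prop :=
  Module.finrank F V = 6 ∧ IsNondegenerate φ ∧ HasTrivialArf φ

/-- `φ` represents the scalar `c`. -/
def Represents (φ : QuadraticForm F V) (c : F) : Prop :=
  ∃ v : V, φ v = c ∧ v ≠ 0

/-- The subgroup `Nrd(D*) ⊆ F*` of reduced norms of the quaternion algebra
`D = (a, b]`: the subgroup of nonzero values of its reduced norm form, the
2-Pfister form `⟨⟨a ; b]]` (the value set is already closed under multiplication). -/
def nrdGroup (a b : F) : Subgroup Fˣ :=
  Subgroup.closure { u : Fˣ | Represents (pfisterForm F ![a] b) (u : F) }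

/-- The homogeneous degree-2 polynomial associated to a quadratic form on `Fⁿ`. -/
def qPoly {n : ℕ} (φ : QuadraticForm F (Fin n → F)) : MvPolynomial (Fin n) F :=
  (∑ i, MvPolynomial.C (φ (Pi.single i 1)) * MvPolynomial.X i ^ 2) +
    ∑ i, ∑ j ∈ Finset.univ.filter (fun j => i < j),
      MvPolynomial.C (polar φ (Pi.single i 1) (Pi.single j 1)) *
        MvPolynomial.X i * MvPolynomial.X j

/-- Base change of a quadratic form on `Fⁿ` along `F → K`. -/
def baseChangeFin {n : ℕ} (φ : QuadraticForm F (Fin n → F)) (K : Type) [Field K]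
    [Algebra F K] : QuadraticForm K (Fin n → K) :=
  (∑ i, algebraMap F K (φ (Pi.single i 1)) •
      linMulLin (LinearMap.proj i) (LinearMap.proj i)) +
    ∑ i, ∑ j ∈ Finset.univ.filter (fun j => i < j),
      algebraMap F K (polar φ (Pi.single i 1) (Pi.single j 1)) •
        linMulLin (LinearMap.proj i) (LinearMap.proj j)

/-- The homogeneous coordinate ring of the quadric (affine cone) defined by `φ`. -/
abbrev coneRing {n : ℕ} (φ : QuadraticForm F (Fin n → F)) : Type :=
  MvPolynomial (Fin n) F ⧸ Ideal.span {qPoly φ}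

end

end Char2Quadrics

namespace Char2Quadrics

open Matrix Polynomial

section MatrixForms
variable {ι : Type*} [Fintype ι] {R S : Type*} [CommRing R] [CommRing S]

/-- The quadratic form `z ↦ zᵀ c z` of a square matrix. -/
def qf (c : Matrix ι ι R) (z : ι → R) : R := z ⬝ᵥ (c *ᵥ z)

/-- The polar form of `qf c`. -/
def bl (c : Matrix ι ι R) (z w : ι → R) : R := z ⬝ᵥ (c *ᵥ w) + w ⬝ᵥ (c *ᵥ z)

lemma qf_add (c : Matrix ι ι R) (z w : ι → R) : qf c (z + w) = qf c z + qf c w + bl c z w := by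
  simp only [qf, bl, mulVec_add, dotProduct_add, add_dotProduct]; ring

lemma qf_smul (c : Matrix ι ι R) (a : R) (z : ι → R) : qf c (a • z) = a ^ 2 * qf c z := by
  simp only [qf, mulVec_smul, dotProduct_smul, smul_dotProduct, smul_eq_mul]; ring

@[simp] lemma qf_zero (c : Matrix ι ι R) : qf c 0 = 0 := by simp [qf]

lemma bl_comm (c : Matrix ι ι R) (z w : ι → R) : bl c z w = bl c w z := by
  simp only [bl]; ring

lemma bl_self (c : Matrix ι ι R) (z : ι → R) : bl c z z = 2 * qf c z := by
  simp only [bl, qf]; ring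

lemma bl_add_left (c : Matrix ι ι R) (z z' w : ι → R) :
    bl c (z + z') w = bl c z w + bl c z' w := by
  simp only [bl, mulVec_add, dotProduct_add, add_dotProduct]; ring

lemma bl_smul_left (c : Matrix ι ι R) (a : R) (z w : ι → R) :
    bl c (a • z) w = a * bl c z w := by
  simp only [bl, mulVec_smul, dotProduct_smul, smul_dotProduct, smul_eq_mul]; ring

lemma bl_add_right (c : Matrix ι ι R) (z w w' : ι → R) :
    bl c z (w + w') = bl c z w + bl c z w' := by
  rw [bl_comm, bl_add_left, bl_comm c w, bl_comm c w']

lemma bl_smul_right (c : Matrix ι ι R) (a : R) (z w : ι → R) :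
    bl c z (a • w) = a * bl c z w := by
  rw [bl_comm, bl_smul_left, bl_comm]

@[simp] lemma bl_zero_left (c : Matrix ι ι R) (w : ι → R) : bl c 0 w = 0 := by simp [bl]

lemma qf_map (φ : R →+* S) (c : Matrix ι ι R) (z : ι → R) :
    qf (c.map φ) (φ ∘ z) = φ (qf c z) := by
  simp only [qf, RingHom.map_dotProduct]
  congr 1
  funext i
  simp [RingHom.map_mulVec]

lemma bl_map (φ : R →+* S) (c : Matrix ι ι R) (z w : ι → R) :
    bl (c.map φ) (φ ∘ z) (φ ∘ w) = φ (bl c z w) := by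
  have h (z w : ι → R) : (φ ∘ z) ⬝ᵥ ((c.map φ) *ᵥ (φ ∘ w)) = φ (z ⬝ᵥ (c *ᵥ w)) := by
    rw [RingHom.map_dotProduct]
    congr 1
    funext i
    simp [RingHom.map_mulVec]
  simp only [bl, h, map_add]

/-- `qf c` has no nontrivial zero. -/
def Aniso (c : Matrix ι ι R) : Prop := ∀ z, qf c z = 0 → z = 0

end MatrixForms

section CasselsPfister
variable {ι : Type*} [Fintype ι] {L : Type*} [Field L]

lemma natDegree_dotProduct_mulVec_le (c : Matrix ι ι L) {z w : ι → L[X]} {m n : ℕ}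
    (hz : ∀ i, (z i).natDegree ≤ m) (hw : ∀ i, (w i).natDegree ≤ n) :
    (z ⬝ᵥ ((c.map C) *ᵥ w)).natDegree ≤ m + n ∧
      (z ⬝ᵥ ((c.map C) *ᵥ w)).coeff (m + n) =
        (fun i => (z i).coeff m) ⬝ᵥ (c *ᵥ fun i => (w i).coeff n) := by
  have hd (i) : ((c.map C *ᵥ w) i).natDegree ≤ n := by
    simp only [mulVec, dotProduct, Matrix.map_apply]
    exact natDegree_sum_le_of_forall_le _ _ fun j _ => (natDegree_C_mul_le _ _).trans (hw j)
  constructor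
  · simp only [dotProduct]
    exact natDegree_sum_le_of_forall_le _ _ fun j _ =>
      natDegree_mul_le.trans (add_le_add (hz j) (hd j))
  · simp only [dotProduct, finsetSum_coeff]
    refine Finset.sum_congr rfl fun i _ => ?_
    rw [coeff_mul_add_eq_of_natDegree_le (hz i) (hd i)]
    simp [mulVec, dotProduct, finsetSum_coeff]

lemma natDegree_qf_le (c : Matrix ι ι L) {z : ι → L[X]} {n : ℕ}
    (hz : ∀ i, (z i).natDegree ≤ n) : (qf (c.map C) z).natDegree ≤ n + n :=
  (natDegree_dotProduct_mulVec_le c hz hz).1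

lemma coeff_qf (c : Matrix ι ι L) {z : ι → L[X]} {n : ℕ} (hz : ∀ i, (z i).natDegree ≤ n) :
    (qf (c.map C) z).coeff (n + n) = qf c fun i => (z i).coeff n :=
  (natDegree_dotProduct_mulVec_le c hz hz).2

lemma natDegree_le_of_natDegree_qf_le {c : Matrix ι ι L} (hc : Aniso c) {z : ι → L[X]} {n : ℕ}
    (hz : (qf (c.map C) z).natDegree ≤ n + n) (i : ι) : (z i).natDegree ≤ n := by
  by_contra! hlt
  obtain ⟨j, -, hj⟩ := Finset.exists_max_image Finset.univ (fun i => (z i).natDegree) ⟨i, by simp⟩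
  have hn := hlt.trans_le (hj i (by simp))
  have := coeff_qf c (z := z) (n := (z j).natDegree) fun i => hj i (by simp)
  rw [coeff_eq_zero_of_natDegree_lt (by omega)] at this
  have h0 := congrFun (hc _ this.symm) j
  simp only [coeff_natDegree, Pi.zero_apply, leadingCoeff_eq_zero] at h0
  simp [h0] at hn

lemma Aniso.map_C {c : Matrix ι ι L} (hc : Aniso c) : Aniso (c.map (C : L →+* L[X])) := by
  intro z hz
  have hd := natDegree_le_of_natDegree_qf_le hc (z := z) (n := 0) (by simp [hz])
  have h := coeff_qf c hd
  rw [hz] at h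
  have h0 := hc _ h.symm
  funext i
  rw [eq_C_of_natDegree_le_zero (hd i)]
  simpa using congrFun h0 i

/-- Cassels–Pfister theorem for an anisotropic form, with linear side conditions. -/
theorem exists_qf_eq_of_qf_eq_sq_mul {c : Matrix ι ι L} (hc : Aniso c) (p : L[X])
    (J : Set (ι → L)) (T : (ι → L) → L[X]) (f : ι → L[X]) (g : L[X]) (hg : g ≠ 0)
    (hf : qf (c.map C) f = g ^ 2 * p)
    (hJ : ∀ w ∈ J, bl (c.map C) f (C ∘ w) = g * T w) :
    ∃ h, qf (c.map C) h = p ∧ ∀ w ∈ J, bl (c.map C) h (C ∘ w) = T w := by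
  induction hn : g.natDegree using Nat.strong_induction_on generalizing f g with
  | _ n ih =>
  set h : ι → L[X] := fun i => f i / g with hh
  set r : ι → L[X] := fun i => f i % g with hr
  have hfr : f = g • h + r := by
    funext i; simp [hh, hr, EuclideanDomain.div_add_mod]
  by_cases hr0 : r = 0
  · refine ⟨h, ?_, fun w hw => ?_⟩
    · rw [hfr, hr0, add_zero, qf_smul] at hf
      exact mul_left_cancel₀ (pow_ne_zero 2 hg) hf
    · have := hJ w hw
      rw [hfr, hr0, add_zero, bl_smul_left] at this
      exact mul_left_cancel₀ hg this
  have hgn : g.natDegree ≠ 0 := by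
    intro h0
    apply hr0
    obtain ⟨a, ha⟩ := natDegree_eq_zero.mp h0
    have : IsUnit g := by
      rw [← ha]; exact isUnit_C.mpr (isUnit_iff_ne_zero.mpr (by rintro rfl; simp at ha; exact hg ha.symm))
    funext i
    simp [hr, EuclideanDomain.mod_eq_zero, this.dvd]
  have hrd (i) : (r i).natDegree ≤ g.natDegree - 1 := by
    have : (r i).natDegree < g.natDegree := natDegree_mod_lt _ hgn
    omega
  set κ := qf (c.map C) h - p with hκ
  set g' := g * p - bl (c.map C) f h + g * qf (c.map C) h with hg'
  have hblfh : bl (c.map C) f h = g * (2 * qf (c.map C) h) + bl (c.map C) h r := by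
    rw [hfr, bl_add_left, bl_smul_left, bl_self, bl_comm _ r]
  have hqr : qf (c.map C) r = g * g' := by
    have : qf (c.map C) f = g ^ 2 * qf (c.map C) h + qf (c.map C) r + g * bl (c.map C) h r := by
      rw [hfr, qf_add, qf_smul, bl_smul_left]
    rw [hf] at this
    rw [hg', hblfh]
    linear_combination -this
  have hg'0 : g' ≠ 0 := fun h0 => hr0 (hc.map_C _ (by rw [hqr, h0, mul_zero]))
  have hlt : g'.natDegree < n := by
    have h1 := natDegree_qf_le c hrd
    rw [hqr, natDegree_mul hg hg'0] at h1
    omega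
  have hJr (w) (hw : w ∈ J) : bl (c.map C) h (C ∘ w) = T w ∧ bl (c.map C) r (C ∘ w) = 0 := by
    have h1 := hJ w hw
    rw [hfr, bl_add_left, bl_smul_left] at h1
    have h2 : (bl (c.map C) r (C ∘ w)).natDegree < g.natDegree := by
      have h3 : ∀ i, ((C ∘ w) i).natDegree ≤ 0 := by simp
      have := (natDegree_add_le_of_degree_le (natDegree_dotProduct_mulVec_le c hrd h3).1
        ((natDegree_dotProduct_mulVec_le c h3 hrd).1.trans (by omega)))
      simp only [bl]
      omega
    have h3 : bl (c.map C) r (C ∘ w) = g * (T w - bl (c.map C) h (C ∘ w)) := by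
      linear_combination h1
    have h4 : T w - bl (c.map C) h (C ∘ w) = 0 := by
      by_contra hne
      rw [h3, natDegree_mul hg hne] at h2
      omega
    exact ⟨(sub_eq_zero.mp h4).symm, by rw [h3, h4, mul_zero]⟩
  refine ih _ hlt (g' • h + κ • r) g' hg'0 ?_ ?_ rfl
  · rw [qf_add, qf_smul, qf_smul, bl_smul_left, bl_smul_right, hqr]
    have : bl (c.map C) h r = - (g * κ) - g' := by
      rw [hg', hblfh, hκ]; ring
    rw [this, hκ]; ring
  · intro w hw
    rw [bl_add_left, bl_smul_left, bl_smul_left, (hJr w hw).1, (hJr w hw).2]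
    ring

/-- Specialization step: a solution over `L(X)` for the vector `x' + X v` gives one over `L`
for `x'` that is moreover compatible with `v`. -/
theorem exists_specialization {c : Matrix ι ι L} (hc : Aniso c) [CharP L 2] (a : L)
    (x v : ι → L) (J : Set (ι → L)) (f : ι → L[X]) (g : L[X]) (hg : g ≠ 0)
    (hf : qf (c.map C) f = g ^ 2 * (C a + qf (c.map C) (C ∘ x + (X : L[X]) • (C ∘ v))))
    (hJ : ∀ w ∈ J, bl (c.map C) f (C ∘ w) =
      g * bl (c.map C) (C ∘ x + (X : L[X]) • (C ∘ v)) (C ∘ w)) :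
    ∃ z, qf c z = a + qf c x ∧ ∀ w ∈ insert v J, bl c z w = bl c x w := by
  obtain ⟨h, h1, h2⟩ := exists_qf_eq_of_qf_eq_sq_mul hc _ J _ f g hg hf hJ
  rw [qf_add, qf_smul, bl_smul_right, qf_map, qf_map, bl_map] at h1
  have hp : C a + (C (qf c x) + X ^ 2 * C (qf c v) + X * C (bl c x v)) =
    C (a + qf c x) + C (bl c x v) * X + C (qf c v) * X ^ 2 := by rw [C_add]; ring
  rw [hp] at h1
  have hd := natDegree_le_of_natDegree_qf_le hc (z := h) (n := 1) (by rw [h1]; compute_degree)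
  set z0 : ι → L := fun i => (h i).coeff 0 with hz0
  set z1 : ι → L := fun i => (h i).coeff 1 with hz1
  have hh : h = C ∘ z0 + (X : L[X]) • (C ∘ z1) := by
    funext i
    conv_lhs => rw [eq_X_add_C_of_natDegree_le_one (hd i)]
    simp [hz0, hz1]; ring
  rw [hh, qf_add, qf_smul, bl_smul_right, qf_map, qf_map, bl_map] at h1
  have hp' : (C (qf c z0) + X ^ 2 * C (qf c z1) + X * C (bl c z0 z1)) =
    C (qf c z0) + C (bl c z0 z1) * X + C (qf c z1) * X ^ 2 := by ring
  rw [hp'] at h1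
  have e0 : qf c z0 = a + qf c x := by simpa using congrArg (coeff · 0) h1
  have e1 : bl c z0 z1 = bl c x v := by
    simpa [coeff_X, coeff_C] using congrArg (coeff · 1) h1
  have e2 : qf c z1 = qf c v := by simpa [coeff_X, coeff_C] using congrArg (coeff · 2) h1
  have eJ (w) (hw : w ∈ J) : bl c z0 w = bl c x w ∧ bl c z1 w = bl c v w := by
    have := h2 w hw
    rw [hh] at this
    simp only [bl_add_left, bl_smul_left, bl_map] at this
    have h0 := congrArg (coeff · 0) this
    have h1 := congrArg (coeff · 1) this
    simp at h0 h1
    exact ⟨h0, h1⟩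
  set δ := z1 + v with hδ
  have h2' : (2 : L) = 0 := CharTwo.two_eq_zero
  by_cases hδ0 : δ = 0
  · have hv : z1 = v := by
      funext i
      have := congrFun hδ0 i
      exact CharTwo.add_eq_zero.mp this
    refine ⟨z0, e0, ?_⟩
    rintro w (rfl | hw)
    · rw [← e1, hv]
    · exact (eJ w hw).1
  · have hq : qf c δ ≠ 0 := fun h => hδ0 (hc _ h)
    have hqδ : qf c δ = bl c v δ := by
      rw [hδ, qf_add, bl_add_right, bl_self, e2, bl_comm c v z1]
      ring
    refine ⟨z0 + (bl c z0 δ / qf c δ) • δ, ?_, ?_⟩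
    · rw [qf_add, qf_smul, bl_smul_right, e0]
      field_simp
      linear_combination (bl c z0 δ ^ 2) * h2'
    · rintro w (rfl | hw)
      · rw [bl_add_left, bl_smul_left, bl_comm c δ, ← hqδ, div_mul_cancel₀ _ hq, ← e1, hδ,
          bl_add_right]
        linear_combination (bl c z0 w) * h2'
      · rw [bl_add_left, bl_smul_left, (eJ w hw).1]
        have : bl c δ w = 0 := by
          rw [hδ, bl_add_left, (eJ w hw).2]
          linear_combination (bl c v w) * h2'
        rw [this, mul_zero, add_zero]

end CasselsPfister

end Char2Quadrics

namespace Char2Quadrics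

open Matrix Polynomial IntermediateField

section PurelyTranscendental
variable {F K : Type*} [Field F] [Field K] [Algebra F K] {ι : Type*} [Fintype ι]

/-- `qf c` has no nontrivial zero with coordinates in `L`. -/
def AnisoOver (L : IntermediateField F K) (c : Matrix ι ι K) : Prop :=
  ∀ z : ι → K, (∀ i, z i ∈ L) → qf c z = 0 → z = 0

lemma exists_common_denom (S : Set K) {ξ : K} (hξ : Transcendental (adjoin F S) ξ)
    (z : ι → K) (hz : ∀ i, z i ∈ adjoin F (insert ξ S)) :
    ∃ (f : ι → (adjoin F S)[X]) (g : (adjoin F S)[X]), g ≠ 0 ∧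
      ∀ i, aeval ξ (f i) = aeval ξ g * z i := by
  classical
  have h1 (i) : ∃ r s : (adjoin F S)[X], s ≠ 0 ∧ aeval ξ r = aeval ξ s * z i := by
    have := hz i
    rw [Set.insert_eq, Set.union_comm, ← adjoin_adjoin_left, mem_restrictScalars,
      mem_adjoin_simple_iff] at this
    obtain ⟨r, s, h⟩ := this
    by_cases hs : s = 0
    · exact ⟨0, 1, one_ne_zero, by simp [h, hs]⟩
    · refine ⟨r, s, hs, ?_⟩
      have : aeval ξ s ≠ 0 := fun h0 => hs ((transcendental_iff.mp hξ) s h0)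
      rw [h]; field_simp
  choose r s hs h using h1
  refine ⟨fun i => r i * ∏ j ∈ Finset.univ.erase i, s j, ∏ j, s j,
    Finset.prod_ne_zero_iff.mpr fun i _ => hs i, fun i => ?_⟩
  rw [map_mul, h, ← Finset.mul_prod_erase Finset.univ s (Finset.mem_univ i), map_mul]
  ring

lemma Aniso.of_anisoOver {L : IntermediateField F K} {c : Matrix ι ι L}
    (h : AnisoOver L (c.map (algebraMap L K))) : Aniso c := by
  intro z hz
  have := h (algebraMap L K ∘ z) (fun i => (z i).2) (by rw [qf_map, hz, map_zero])
  funext i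
  have h2 := congrFun this i
  simpa using h2

omit [Fintype ι] in
lemma exists_matrix_lift (L : IntermediateField F K) {c : Matrix ι ι K} (hc : ∀ i j, c i j ∈ L) :
    ∃ d : Matrix ι ι L, d.map (algebraMap L K) = c :=
  ⟨fun i j => ⟨c i j, hc i j⟩, rfl⟩

omit [Fintype ι] in
lemma exists_lift (L : IntermediateField F K) {z : ι → K} (hz : ∀ i, z i ∈ L) :
    ∃ d : ι → L, algebraMap L K ∘ d = z :=
  ⟨fun i => ⟨z i, hz i⟩, rfl⟩

omit [Fintype ι] in
lemma map_C_map_aeval {L : IntermediateField F K} (ξ : K) (d : Matrix ι ι L) :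
    (d.map (C : L →+* L[X])).map (aeval ξ : L[X] →ₐ[L] K).toRingHom = d.map (algebraMap L K) := by
  ext i j; simp

/-- Anisotropy is preserved by purely transcendental extensions. -/
theorem AnisoOver.adjoin_insert {S : Set K} {ξ : K} (hξ : Transcendental (adjoin F S) ξ)
    {c : Matrix ι ι K} (hc : ∀ i j, c i j ∈ adjoin F S) (h : AnisoOver (adjoin F S) c) :
    AnisoOver (adjoin F (insert ξ S)) c := by
  obtain ⟨d, rfl⟩ := exists_matrix_lift _ hc
  have hd := (Aniso.of_anisoOver h).map_C
  intro z hz h0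
  obtain ⟨f, g, hg, hf⟩ := exists_common_denom S hξ z hz
  have hg' : aeval ξ g ≠ 0 := fun h0 => hg ((transcendental_iff.mp hξ) g h0)
  have hfz : (aeval ξ : (adjoin F S)[X] →ₐ[adjoin F S] K).toRingHom ∘ f = aeval ξ g • z := by
    funext i; simpa using hf i
  have : qf (d.map C) f = 0 := by
    apply (transcendental_iff.mp hξ)
    have := qf_map (aeval ξ : (adjoin F S)[X] →ₐ[adjoin F S] K).toRingHom (d.map C) f
    rw [hfz, map_C_map_aeval, qf_smul, h0, mul_zero] at this
    exact this.symm
  have hf0 := hd _ this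
  funext i
  have := hf i
  rw [hf0] at this
  simpa [hg'] using this

theorem exists_specialization_adjoin [CharP K 2] {S : Set K} {ξ : K}
    (hξ : Transcendental (adjoin F S) ξ)
    {c : Matrix ι ι K} (hc : ∀ i j, c i j ∈ adjoin F S) (h : AnisoOver (adjoin F S) c)
    {a : K} (ha : a ∈ adjoin F S) {x v : ι → K} (hx : ∀ i, x i ∈ adjoin F S)
    (hv : ∀ i, v i ∈ adjoin F S) {J : Set (ι → K)} (hJ : ∀ w ∈ J, ∀ i, w i ∈ adjoin F S)
    (hz : ∃ z : ι → K, (∀ i, z i ∈ adjoin F (insert ξ S)) ∧ qf c z = a + qf c (x + ξ • v) ∧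
      ∀ w ∈ J, bl c z w = bl c (x + ξ • v) w) :
    ∃ z : ι → K, (∀ i, z i ∈ adjoin F S) ∧ qf c z = a + qf c x ∧
      ∀ w ∈ insert v J, bl c z w = bl c x w := by
  obtain ⟨z, hz, hqz, hJz⟩ := hz
  obtain ⟨d, rfl⟩ := exists_matrix_lift _ hc
  have hd := Aniso.of_anisoOver h
  obtain ⟨x, rfl⟩ := exists_lift _ hx
  obtain ⟨v, rfl⟩ := exists_lift _ hv
  have : CharP (adjoin F S) 2 :=
    (algebraMap (adjoin F S) K).charP (algebraMap (adjoin F S) K).injective 2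
  obtain ⟨f, g, hg, hf⟩ := exists_common_denom S hξ z hz
  set e : (adjoin F S)[X] →+* K := (aeval ξ : (adjoin F S)[X] →ₐ[adjoin F S] K).toRingHom with he
  have heinj : Function.Injective e := by
    rw [injective_iff_map_eq_zero]
    exact fun p hp => (transcendental_iff.mp hξ) p hp
  have hfz : e ∘ f = e g • z := by
    funext i; simpa [he] using hf i
  have hex : e ∘ (C ∘ x + (X : (adjoin F S)[X]) • (C ∘ v)) =
      algebraMap (adjoin F S) K ∘ x + ξ • (algebraMap (adjoin F S) K ∘ v) := by
    funext i; simp [he]; ring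
  have heC (w : ι → adjoin F S) : e ∘ (C ∘ w) = algebraMap (adjoin F S) K ∘ w := by
    funext i; simp [he]
  obtain ⟨y, hy, hyJ⟩ := exists_specialization hd ⟨a, ha⟩ x v
    {w | algebraMap (adjoin F S) K ∘ w ∈ J} f g hg
    (by
      apply heinj
      rw [map_mul, map_pow, map_add, ← qf_map, ← qf_map, hex, hfz, map_C_map_aeval, qf_smul, hqz]
      simp [he])
    (by
      intro w hw
      apply heinj
      rw [map_mul, ← bl_map, ← bl_map, hex, hfz, map_C_map_aeval, bl_smul_left, heC, hJz _ hw])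
  refine ⟨algebraMap _ K ∘ y, fun i => (y i).2, ?_, ?_⟩
  · rw [qf_map, hy, qf_map, map_add]; rfl
  · rintro w (rfl | hw)
    · rw [bl_map, bl_map, hyJ v (by simp)]
    · obtain ⟨w, rfl⟩ := exists_lift _ (hJ w hw)
      rw [bl_map, bl_map, hyJ w (by right; exact hw)]

open scoped algebraAdjoinAdjoin in
lemma transcendental_adjoin_image {κ : Type*} {v : κ → K}
    (hv : AlgebraicIndependent F v) {s : Set κ} {i : κ} (hi : i ∉ s) :
    Transcendental (adjoin F (v '' s)) (v i) := by
  have h := hv.transcendental_adjoin hi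
  intro h2
  exact h ((IsFractionRing.isAlgebraic_iff (Algebra.adjoin F (v '' s)) (adjoin F (v '' s)) K).mpr h2)

end PurelyTranscendental

end Char2Quadrics

namespace Char2Quadrics

open Matrix QuadraticMap

section BlockForms
variable {R S : Type*} [CommRing R] [CommRing S]

lemma qf_fromBlocks {m n : Type*} [Fintype m] [Fintype n] (A : Matrix m m R) (D : Matrix n n R)
    (z : m ⊕ n → R) :
    qf (fromBlocks A 0 0 D) z = qf A (z ∘ Sum.inl) + qf D (z ∘ Sum.inr) := by
  conv_lhs => rw [← Sum.elim_comp_inl_inr z]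
  simp only [qf, fromBlocks_mulVec, Matrix.zero_mulVec, add_zero, zero_add,
    sumElim_dotProduct_sumElim, Sum.elim_comp_inl, Sum.elim_comp_inr]

lemma bl_fromBlocks {m n : Type*} [Fintype m] [Fintype n] (A : Matrix m m R) (D : Matrix n n R)
    (z w : m ⊕ n → R) :
    bl (fromBlocks A 0 0 D) z w =
      bl A (z ∘ Sum.inl) (w ∘ Sum.inl) + bl D (z ∘ Sum.inr) (w ∘ Sum.inr) := by
  conv_lhs => rw [← Sum.elim_comp_inl_inr z, ← Sum.elim_comp_inl_inr w]
  simp only [bl, fromBlocks_mulVec, Matrix.zero_mulVec, add_zero, zero_add,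
    sumElim_dotProduct_sumElim, Sum.elim_comp_inl, Sum.elim_comp_inr]
  ring

lemma qf_smul_matrix {m : Type*} [Fintype m] (a : R) (A : Matrix m m R) (z : m → R) :
    qf (a • A) z = a * qf A z := by
  simp [qf, smul_mulVec, dotProduct_smul]

lemma bl_smul_matrix {m : Type*} [Fintype m] (a : R) (A : Matrix m m R) (z w : m → R) :
    bl (a • A) z w = a * bl A z w := by
  simp [bl, smul_mulVec, dotProduct_smul, mul_add]

/-- The matrix of `u[1,b] ⊥ v[1,b+d]`. -/
def tauMat (b d u v : R) : Matrix (Fin 4) (Fin 4) R :=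
  !![u, u, 0, 0; 0, u * b, 0, 0; 0, 0, v, v; 0, 0, 0, v * (b + d)]

/-- The matrix of `τ ⊥ aτ`. -/
def doubleMat {m : Type*} (a : R) (τ : Matrix m m R) : Matrix (m ⊕ m) (m ⊕ m) R :=
  fromBlocks τ 0 0 (a • τ)

/-- The matrix of `[1,d] ⊥ τ`. -/
def albertMat {m : Type*} (d : R) (τ : Matrix m m R) : Matrix (Fin 2 ⊕ m) (Fin 2 ⊕ m) R :=
  fromBlocks !![1, 1; 0, d] 0 0 τ

lemma qf_tauMat (b d u v : R) (z : Fin 4 → R) : qf (tauMat b d u v) z =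
    u * (z 0 ^ 2 + z 0 * z 1 + b * z 1 ^ 2) + v * (z 2 ^ 2 + z 2 * z 3 + (b + d) * z 3 ^ 2) := by
  simp [qf, tauMat, dotProduct, mulVec, Fin.sum_univ_four]; ring

lemma bl_tauMat (b d u v : R) (z w : Fin 4 → R) : bl (tauMat b d u v) z w =
    u * (2 * z 0 * w 0 + z 0 * w 1 + z 1 * w 0 + 2 * b * z 1 * w 1) +
      v * (2 * z 2 * w 2 + z 2 * w 3 + z 3 * w 2 + 2 * (b + d) * z 3 * w 3) := by
  simp [bl, tauMat, dotProduct, mulVec, Fin.sum_univ_four]; ring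

lemma qf_doubleMat {m : Type*} [Fintype m] (a : R) (τ : Matrix m m R) (z : m ⊕ m → R) :
    qf (doubleMat a τ) z = qf τ (z ∘ Sum.inl) + a * qf τ (z ∘ Sum.inr) := by
  rw [doubleMat, qf_fromBlocks, qf_smul_matrix]

lemma bl_doubleMat {m : Type*} [Fintype m] (a : R) (τ : Matrix m m R) (z w : m ⊕ m → R) :
    bl (doubleMat a τ) z w =
      bl τ (z ∘ Sum.inl) (w ∘ Sum.inl) + a * bl τ (z ∘ Sum.inr) (w ∘ Sum.inr) := by
  rw [doubleMat, bl_fromBlocks, bl_smul_matrix]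

lemma qf_albertMat {m : Type*} [Fintype m] (d : R) (τ : Matrix m m R) (z : Fin 2 ⊕ m → R) :
    qf (albertMat d τ) z =
      z (.inl 0) ^ 2 + z (.inl 0) * z (.inl 1) + d * z (.inl 1) ^ 2 + qf τ (z ∘ Sum.inr) := by
  rw [albertMat, qf_fromBlocks]
  simp [qf, dotProduct, mulVec]; ring

lemma bl_albertMat {m : Type*} [Fintype m] (d : R) (τ : Matrix m m R) (z w : Fin 2 ⊕ m → R) :
    bl (albertMat d τ) z w =
      2 * z (.inl 0) * w (.inl 0) + z (.inl 0) * w (.inl 1) + z (.inl 1) * w (.inl 0) +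
        2 * d * z (.inl 1) * w (.inl 1) + bl τ (z ∘ Sum.inr) (w ∘ Sum.inr) := by
  rw [albertMat, bl_fromBlocks]
  simp [bl, dotProduct, mulVec]; ring

lemma tauMat_map (φ : R →+* S) (b d u v : R) :
    (tauMat b d u v).map φ = tauMat (φ b) (φ d) (φ u) (φ v) := by
  ext i j; fin_cases i <;> fin_cases j <;> simp [tauMat]

lemma doubleMat_map {m : Type*} (φ : R →+* S) (a : R) (τ : Matrix m m R) :
    (doubleMat a τ).map φ = doubleMat (φ a) (τ.map φ) := by
  ext (i | i) (j | j) <;> simp [doubleMat]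

lemma albertMat_map {m : Type*} (φ : R →+* S) (d : R) (τ : Matrix m m R) :
    (albertMat d τ).map φ = albertMat (φ d) (τ.map φ) := by
  ext (i | i) (j | j)
  · fin_cases i <;> fin_cases j <;> simp [albertMat]
  all_goals simp [albertMat]

end BlockForms

section PfisterValues
variable {M : Type} [Field M] [CharP M 2]

/-- The values of `Q` are closed under multiplication. -/
def MulClosedValues {V : Type*} [AddCommGroup V] [Module M V] (Q : QuadraticForm M V) : Prop :=
  ∀ x y, ∃ z, Q z = Q x * Q y

omit [CharP M 2] in
lemma MulClosedValues.div {V : Type*} [AddCommGroup V] [Module M V] {Q : QuadraticForm M V}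
    (h : MulClosedValues Q) (x y : V) : ∃ z, Q z = Q x / Q y := by
  obtain ⟨z, hz⟩ := h x y
  refine ⟨(Q y)⁻¹ • z, ?_⟩
  rw [QuadraticMap.map_smul, hz, smul_eq_mul]
  by_cases hy : Q y = 0
  · simp [hy]
  · field_simp

lemma MulClosedValues.prod {V : Type*} [AddCommGroup V] [Module M V] {Q : QuadraticForm M V}
    (h : MulClosedValues Q) (g : M) : MulClosedValues (Q.prod (g • Q)) := by
  rintro ⟨x, x'⟩ ⟨y, y'⟩
  simp only [Prod.exists, QuadraticMap.prod_apply, _root_.smul_apply, smul_eq_mul]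
  by_cases hA : Q x = 0
  · obtain ⟨z, hz⟩ := h x' y
    obtain ⟨z', hz'⟩ := h x' y'
    exact ⟨g • z', z, by rw [QuadraticMap.map_smul, hz, hz', hA, smul_eq_mul]; ring⟩
  by_cases hB : Q x' = 0
  · obtain ⟨z, hz⟩ := h x y
    obtain ⟨z', hz'⟩ := h x y'
    exact ⟨z, z', by rw [hz, hz', hB]; ring⟩
  obtain ⟨w, hw⟩ := h x x'
  obtain ⟨y₁, hy₁⟩ := h.div y' w
  rw [hw] at hy₁
  obtain ⟨z, hz⟩ := h x (y + (g * Q x') • y₁)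
  obtain ⟨z', hz'⟩ := h x' (y + Q x • y₁)
  refine ⟨z, z', ?_⟩
  have hy' : Q y' = Q x * Q x' * Q y₁ := by rw [hy₁]; field_simp
  rw [hz, hz', hy', QuadraticMap.map_add Q, QuadraticMap.map_add Q, QuadraticMap.map_smul,
    QuadraticMap.map_smul, QuadraticMap.polar_smul_right, QuadraticMap.polar_smul_right]
  simp only [smul_eq_mul]
  have h2 : (2 : M) = 0 := CharTwo.two_eq_zero
  linear_combination (g * Q x * Q x' * polar Q y y₁) * h2

omit [CharP M 2] in
lemma binForm_apply (b x y : M) : binForm M b (x, y) = x ^ 2 + x * y + b * y ^ 2 := by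
  simp [binForm]; ring

lemma mulClosedValues_binForm (b : M) : MulClosedValues (binForm M b) := by
  rintro ⟨x, y⟩ ⟨x', y'⟩
  refine ⟨(x * x' + b * (y * y'), x * y' + x' * y + y * y'), ?_⟩
  simp only [binForm_apply]
  grind

/-- The form `[1,b] ⊥ a[1,b] ⊥ g([1,b] ⊥ a[1,b])`. -/
def threefold (b a g : M) : QuadraticForm M (((M × M) × (M × M)) × ((M × M) × (M × M))) :=
  ((binForm M b).prod (a • binForm M b)).prod (g • (binForm M b).prod (a • binForm M b))

lemma mulClosedValues_threefold (b a g : M) : MulClosedValues (threefold b a g) :=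
  ((mulClosedValues_binForm b).prod a).prod g

omit [CharP M 2] in
lemma threefold_apply (b a g x y z w x' y' z' w' : M) :
    threefold b a g (((x, y), (z, w)), ((x', y'), (z', w'))) =
      x ^ 2 + x * y + b * y ^ 2 + a * (z ^ 2 + z * w + b * w ^ 2) +
        g * (x' ^ 2 + x' * y' + b * y' ^ 2 + a * (z' ^ 2 + z' * w' + b * w' ^ 2)) := by
  simp [threefold, binForm_apply]

lemma exists_threefold_eq {b d u v t : M} (ht : t ≠ 0) (z : Fin 4 ⊕ Fin 4 → M) :
    ∃ w, threefold b (1 + t + d * t ^ 2) (u * v) w =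
      u * qf (doubleMat (1 + t + d * t ^ 2) (tauMat b d u v)) z := by
  set a := 1 + t + d * t ^ 2 with ha
  refine ⟨(((u * z (.inl 0), u * z (.inl 1)), (u * z (.inr 0), u * z (.inr 1))),
    ((z (.inl 2) + z (.inl 3) / t + z (.inr 3) * a / t, z (.inl 3)),
      (z (.inr 2) + z (.inl 3) / t + z (.inr 3) / t, z (.inr 3)))), ?_⟩
  rw [threefold_apply, qf_doubleMat, qf_tauMat, qf_tauMat]
  simp only [Function.comp]
  field_simp
  grind

lemma exists_doubleMat_eq {b d u v t : M} (ht : t ≠ 0) (hu : u ≠ 0)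
    (w : ((M × M) × (M × M)) × ((M × M) × (M × M))) :
    ∃ z, u * qf (doubleMat (1 + t + d * t ^ 2) (tauMat b d u v)) z =
      threefold b (1 + t + d * t ^ 2) (u * v) w := by
  obtain ⟨⟨⟨x, y⟩, ⟨z, w⟩⟩, ⟨⟨x', y'⟩, ⟨z', w'⟩⟩⟩ := w
  set a := 1 + t + d * t ^ 2 with ha
  refine ⟨Sum.elim ![x / u, y / u, x' + y' / t + w' * a / t, y']
    ![z / u, w / u, z' + y' / t + w' / t, w'], ?_⟩
  rw [threefold_apply, qf_doubleMat, qf_tauMat, qf_tauMat]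
  simp only [Sum.elim_comp_inl, Sum.elim_comp_inr, cons_val]
  field_simp
  grind

/-- If `τ ⊥ aτ` becomes isotropic in a particular way over a quadratic inseparable extension,
then it represents `a + τ(x)`. -/
theorem exists_doubleMat_eq_add {b d u v t a : M} (ht : t ≠ 0) (hu : u ≠ 0)
    (ha : a = 1 + t + d * t ^ 2) (ha0 : a ≠ 0)
    (han : Aniso (doubleMat a (tauMat b d u v))) (x : Fin 4 → M)
    (hx : qf (tauMat b d u v) x ≠ 0) (α β : Fin 4 ⊕ Fin 4 → M) (hαβ : α ≠ 0 ∨ β ≠ 0)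
    (h0 : bl (doubleMat a (tauMat b d u v)) α β = 0)
    (h : a * qf (doubleMat a (tauMat b d u v)) α =
      qf (tauMat b d u v) x * qf (doubleMat a (tauMat b d u v)) β) :
    ∃ z, qf (doubleMat a (tauMat b d u v)) z = a + qf (tauMat b d u v) x := by
  set σ := doubleMat a (tauMat b d u v) with hσ
  set T := qf (tauMat b d u v) x with hT
  have hB : qf σ β ≠ 0 := by
    intro hB
    have hα : α = 0 := han _ (by simpa [hB, ha0] using h)
    have hβ := han _ hB
    simp [hα, hβ] at hαβ
  have hA : qf σ α ≠ 0 := by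
    intro hA
    rw [hA, mul_zero] at h
    exact mul_ne_zero hx hB h.symm
  let P : M → Prop := fun p => ∃ w, threefold b a (u * v) w = p
  have hPm {p p' : M} (hp : P p) (hp' : P p') : P (p * p') := by
    obtain ⟨w, rfl⟩ := hp
    obtain ⟨w', rfl⟩ := hp'
    exact mulClosedValues_threefold b a (u * v) w w'
  have hPd {p p' : M} (hp : P p) (hp' : P p') : P (p / p') := by
    obtain ⟨w, rfl⟩ := hp
    obtain ⟨w', rfl⟩ := hp'
    exact (mulClosedValues_threefold b a (u * v)).div w w'
  have hσP (z) : P (u * qf σ z) := by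
    subst ha; exact exists_threefold_eq ht z
  have haP : P a := ⟨(((0, 0), (1, 0)), ((0, 0), (0, 0))), by simp [threefold_apply]⟩
  have hTP : P (u * T) := by
    have := hσP (Sum.elim x 0)
    simpa [hσ, qf_doubleMat] using this
  have hT' : T = a * ((u * qf σ α) / (u * qf σ β)) := by
    field_simp
    linear_combination -h
  have huP : P u := by
    have h1 := hPd hTP (by rw [hT']; exact hPm haP (hPd (hσP α) (hσP β)) : P T)
    rwa [mul_div_cancel_right₀ _ hx] at h1
  have hsum : P (u * (a * ((u * qf σ (α + β)) / (u * qf σ β)))) :=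
    hPm huP (hPm haP (hPd (hσP _) (hσP _)))
  have hs : a * ((u * qf σ (α + β)) / (u * qf σ β)) = a + T := by
    rw [hT', qf_add, h0]
    field_simp
    ring
  rw [hs] at hsum
  obtain ⟨w, hw⟩ := hsum
  obtain ⟨z, hz⟩ : ∃ z, u * qf σ z = threefold b a (u * v) w := by
    subst ha; exact exists_doubleMat_eq ht hu w
  exact ⟨z, mul_left_cancel₀ hu (hz.trans hw)⟩

end PfisterValues

end Char2Quadrics

namespace Char2Quadrics

open Matrix

section Symplectic
variable {F : Type*} [Field F] [CharP F 2] {ι : Type*} [Fintype ι]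

lemma bl_self_eq_zero (c : Matrix ι ι F) (z : ι → F) : bl c z z = 0 := by
  rw [bl_self, CharTwo.two_eq_zero, zero_mul]

lemma exists_symplectic_pair (c : Matrix ι ι F) {e f : ι → F} (h : bl c e f = 1) {x y : F}
    (hw : x • e + y • f ≠ 0) :
    ∃ x' y' : F, bl c (x • e + y • f) (x' • e + y' • f) = 1 ∧
      ∃ ω, qf c (x • e + y • f) * qf c (x' • e + y' • f) = qf c e * qf c f + (ω ^ 2 + ω) := by
  have h' : bl c f e = 1 := by rw [bl_comm, h]
  by_cases hx : x = 0
  · have hy : y ≠ 0 := by rintro rfl; simp [hx] at hw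
    refine ⟨y⁻¹, 0, ?_, 0, ?_⟩
    · simp only [hx, bl_add_left, bl_add_right, bl_smul_left, bl_smul_right, h, h',
        bl_self_eq_zero]
      field_simp; simp
    · simp only [hx, qf_add, qf_smul, bl_smul_left, bl_smul_right, h]
      field_simp; ring
  · refine ⟨0, x⁻¹, ?_, y * qf c f / x, ?_⟩
    · simp only [bl_add_left, bl_add_right, bl_smul_left, bl_smul_right, h, h',
        bl_self_eq_zero]
      field_simp; simp
    · simp only [qf_add, qf_smul, bl_smul_left, bl_smul_right, h]
      field_simp; ring

/-- `e, f, e', f'` span the orthogonal sum of two planes with symplectic bases. -/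
structure Symplectic (c : Matrix ι ι F) (e f e' f' : ι → F) : Prop where
  ef : bl c e f = 1
  ef' : bl c e' f' = 1
  ee' : bl c e e' = 0
  e_f' : bl c e f' = 0
  fe' : bl c f e' = 0
  ff' : bl c f f' = 0

omit [CharP F 2] in
lemma Symplectic.replace_pairs {c : Matrix ι ι F} {e f e' f' : ι → F} (h : Symplectic c e f e' f')
    {x y z w x' y' z' w' : F} (h₁ : bl c (x • e + y • f) (z • e + w • f) = 1)
    (h₂ : bl c (x' • e' + y' • f') (z' • e' + w' • f') = 1) :
    Symplectic c (x • e + y • f) (z • e + w • f) (x' • e' + y' • f') (z' • e' + w' • f') where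
  ef := h₁
  ef' := h₂
  ee' := by simp [bl_add_left, bl_add_right, bl_smul_left, bl_smul_right, h.ee', h.e_f', h.fe', h.ff']
  e_f' := by simp [bl_add_left, bl_add_right, bl_smul_left, bl_smul_right, h.ee', h.e_f', h.fe', h.ff']
  fe' := by simp [bl_add_left, bl_add_right, bl_smul_left, bl_smul_right, h.ee', h.e_f', h.fe', h.ff']
  ff' := by simp [bl_add_left, bl_add_right, bl_smul_left, bl_smul_right, h.ee', h.e_f', h.fe', h.ff']

omit [CharP F 2] in
lemma Symplectic.swap {c : Matrix ι ι F} {e f e' f' : ι → F} (h : Symplectic c e f e' f') :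
    Symplectic c e' f' e f :=
  ⟨h.ef', h.ef, bl_comm c e e' ▸ h.ee', bl_comm c f e' ▸ h.fe', bl_comm c e f' ▸ h.e_f',
    bl_comm c f f' ▸ h.ff'⟩

omit [CharP F 2] in
lemma Symplectic.flip {c : Matrix ι ι F} {e f e' f' : ι → F} (h : Symplectic c e f e' f') :
    Symplectic c f e e' f' :=
  ⟨bl_comm c e f ▸ h.ef, h.ef', h.fe', h.ff', h.ee', h.e_f'⟩

lemma Symplectic.transvect {c : Matrix ι ι F} {e f e' f' : ι → F} (h : Symplectic c e f e' f') :
    Symplectic c (e + e') f e' (f' + f) := by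
  have h1 := h.swap
  have := CharTwo.add_self_eq_zero (1 : F)
  constructor <;>
  simp [bl_add_left, bl_add_right, h.ef, h.ef', h.ee', h.e_f', h.fe', h.ff', h1.e_f', bl_self_eq_zero, this]

/-- Arf invariants of two decompositions agree modulo `℘(F)`. -/
def ArfCongr (c : Matrix ι ι F) (e f e' f' e₁ f₁ e₁' f₁' : ι → F) : Prop :=
  ∃ ω, qf c e₁ * qf c f₁ + qf c e₁' * qf c f₁' =
    qf c e * qf c f + qf c e' * qf c f' + (ω ^ 2 + ω)

theorem Symplectic.exists_of_ne_zero {c : Matrix ι ι F} {e f e' f' : ι → F}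
    (h : Symplectic c e f e' f') {x y x' y' : F}
    (hv : x • e + y • f + (x' • e' + y' • f') ≠ 0) (W : Submodule F (ι → F))
    (he : e ∈ W) (hf : f ∈ W) (he' : e' ∈ W) (hf' : f' ∈ W) :
    ∃ f₁ ∈ W, ∃ e₁' ∈ W, ∃ f₁' ∈ W,
      Symplectic c (x • e + y • f + (x' • e' + y' • f')) f₁ e₁' f₁' ∧
      ArfCongr c e f e' f' (x • e + y • f + (x' • e' + y' • f')) f₁ e₁' f₁' := by
  have mem {a b : F} : a • e + b • f ∈ W := W.add_mem (W.smul_mem _ he) (W.smul_mem _ hf)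
  have mem' {a b : F} : a • e' + b • f' ∈ W := W.add_mem (W.smul_mem _ he') (W.smul_mem _ hf')
  by_cases h0 : x • e + y • f = 0
  · rw [h0, zero_add] at hv ⊢
    obtain ⟨z, w, h1, ω, hω⟩ := exists_symplectic_pair c h.ef' hv
    have := h.replace_pairs (x := 1) (y := 0) (z := 0) (w := 1) (by simp [h.ef]) h1
    simp only [one_smul, zero_smul, add_zero, zero_add] at this
    exact ⟨_, mem', _, he, _, hf, this.swap, ω, by rw [hω]; ring⟩
  obtain ⟨z, w, h1, ω, hω⟩ := exists_symplectic_pair c h.ef h0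
  by_cases h0' : x' • e' + y' • f' = 0
  · rw [h0', add_zero]
    have := h.replace_pairs (x' := 1) (y' := 0) (z' := 0) (w' := 1) h1 (by simp [h.ef'])
    simp only [one_smul, zero_smul, add_zero, zero_add] at this
    exact ⟨_, mem, _, he', _, hf', this, ω, by rw [hω]; ring⟩
  obtain ⟨z', w', h1', ω', hω'⟩ := exists_symplectic_pair c h.ef' h0'
  have hs := h.replace_pairs h1 h1'
  refine ⟨_, mem, _, mem', _, W.add_mem mem' mem, hs.transvect, ω + ω', ?_⟩
  have h2 : (2 : F) = 0 := CharTwo.two_eq_zero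
  rw [qf_add c _ (x' • e' + y' • f'), qf_add c _ (z • e + w • f), hs.ee', hs.swap.ff']
  linear_combination hω + hω' +
    (qf c (x' • e' + y' • f') * qf c (z • e + w • f) - ω * ω') * h2

theorem Symplectic.exists_of_bl_eq_one {c : Matrix ι ι F} {e f e' f' : ι → F}
    (h : Symplectic c e f e' f') {x x' y' : F} (W : Submodule F (ι → F))
    (he' : e' ∈ W) (hf' : f' ∈ W) (he : e ∈ W) :
    ∃ e₁' ∈ W, ∃ f₁' ∈ W,
      Symplectic c e (x • e + f + (x' • e' + y' • f')) e₁' f₁' ∧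
      ArfCongr c e f e' f' e (x • e + f + (x' • e' + y' • f')) e₁' f₁' := by
  have mem' {a b : F} : a • e' + b • f' ∈ W := W.add_mem (W.smul_mem _ he') (W.smul_mem _ hf')
  by_cases h0' : x' • e' + y' • f' = 0
  · rw [h0', add_zero]
    have := h.replace_pairs (x := 1) (y := 0) (z := x) (w := 1) (x' := 1) (y' := 0) (z' := 0)
      (w' := 1) (by simp [h.ef, bl_add_right, bl_smul_right, bl_self_eq_zero]) (by simp [h.ef'])
    simp only [one_smul, zero_smul, add_zero, zero_add] at this
    refine ⟨_, he', _, hf', this, x * qf c e, ?_⟩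
    rw [qf_add, qf_smul, bl_smul_left, h.ef]; ring
  obtain ⟨z', w', h1', ω', hω'⟩ := exists_symplectic_pair c h.ef' h0'
  have hs := h.replace_pairs (x := 1) (y := 0) (z := 0) (w := 1) (by simp [h.ef]) h1'
  simp only [one_smul, zero_smul, add_zero, zero_add] at hs
  have hp : x' • e' + y' • f' ∈ W := mem'
  have hp' : z' • e' + w' • f' ∈ W := mem'
  generalize x' • e' + y' • f' = p at *
  generalize z' • e' + w' • f' = p' at *
  have ht := hs.flip.transvect.flip
  have := ht.replace_pairs (x := 1) (y := 0) (z := x) (w := 1) (x' := 1) (y' := 0) (z' := 0)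
      (w' := 1) (by simp [ht.ef, bl_add_right, bl_smul_right, bl_self_eq_zero]) (by simp [ht.ef'])
  simp only [one_smul, zero_smul, add_zero, zero_add, ← add_assoc] at this
  refine ⟨_, hp, _, W.add_mem hp' he, this, ω' + x * qf c e, ?_⟩
  have h2 : (2 : F) = 0 := CharTwo.two_eq_zero
  rw [qf_add c _ p, qf_add c _ f, qf_add c p' e, qf_smul, bl_smul_left, bl_add_left, bl_smul_left,
    hs.ef, hs.ee', hs.fe', hs.swap.fe']
  linear_combination hω' + (qf c e * qf c p - ω' * x * qf c e) * h2

end Symplectic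

end Char2Quadrics

namespace Char2Quadrics

open Matrix

section NormalForm
variable {F : Type*} [Field F] {ι : Type*} [Fintype ι]

lemma bl_sum_left {κ : Type*} (c : Matrix ι ι F) (s : Finset κ) (z : κ → ι → F) (w : ι → F) :
    bl c (∑ k ∈ s, z k) w = ∑ k ∈ s, bl c (z k) w := by
  classical
  induction s using Finset.induction_on with
  | empty => simp
  | insert a s ha ih => rw [Finset.sum_insert ha, Finset.sum_insert ha, bl_add_left, ih]

/-- A family with a dual family for the polar form, as the columns of an invertible matrix. -/
lemma exists_inverse_of_dual [DecidableEq ι] {κ : Type*} [Fintype κ] [DecidableEq κ]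
    (c : Matrix ι ι F) (b b' : κ → ι → F)
    (h : ∀ i j, bl c (b i) (b' j) = if i = j then 1 else 0)
    (hcard : Fintype.card κ = Fintype.card ι) :
    ∃ P' : Matrix κ ι F, P' * (of b)ᵀ = 1 ∧ (of b)ᵀ * P' = 1 := by
  have h1 : (of fun j i => bl c (Pi.single i 1) (b' j) : Matrix κ ι F) * (of b)ᵀ = 1 := by
    ext j k
    rw [mul_apply, one_apply]
    have : b k = ∑ i, b k i • (Pi.single i 1 : ι → F) := by
      rw [← pi_eq_sum_univ' (b k)]
    have h2 := h k j
    rw [this, bl_sum_left] at h2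
    simp only [bl_smul_left] at h2
    simp only [of_apply, transpose_apply]
    simp only [mul_comm (bl c _ _), h2, eq_comm]
  exact ⟨_, h1, (mul_eq_one_comm_of_card_eq _ _ _ hcard).mp h1⟩

lemma eq_sum_of_dual [DecidableEq ι] {κ : Type*} [Fintype κ] [DecidableEq κ]
    (c : Matrix ι ι F) (b b' : κ → ι → F)
    (h : ∀ i j, bl c (b i) (b' j) = if i = j then 1 else 0)
    (hcard : Fintype.card κ = Fintype.card ι) (v : ι → F) :
    v = ∑ k, bl c v (b' k) • b k := by
  obtain ⟨P', -, h2⟩ := exists_inverse_of_dual c b b' h hcard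
  have hv : v = ∑ k, (P' *ᵥ v) k • b k := by
    conv_lhs => rw [← one_mulVec v, ← h2, ← mulVec_mulVec]
    funext i
    simp [mulVec, dotProduct, mul_comm]
  have (j : κ) : bl c v (b' j) = (P' *ᵥ v) j := by
    conv_lhs => rw [hv]
    simp [bl_sum_left, bl_smul_left, h]
  simp_rw [this]
  exact hv

variable [CharP F 2]

lemma Aniso.mul_ne_artinSchreier {c : Matrix ι ι F} (hc : Aniso c) {e f : ι → F}
    (h : bl c e f = 1) (ω : F) : qf c e * qf c f ≠ ω ^ 2 + ω := by
  intro hω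
  have h2 : (2 : F) = 0 := CharTwo.two_eq_zero
  have hz : ω • e + qf c e • f = 0 := by
    apply hc
    rw [qf_add, qf_smul, qf_smul, bl_smul_left, bl_smul_right, h]
    linear_combination qf c e * hω + qf c e * (ω ^ 2 + ω) * h2
  have h1 : bl c (ω • e + qf c e • f) e = 0 := by rw [hz, bl_zero_left]
  rw [bl_add_left, bl_smul_left, bl_smul_left, bl_self_eq_zero, bl_comm c f, h] at h1
  have : e = 0 := hc _ (by simpa using h1)
  simp [this] at h

lemma Symplectic.eq_combination {c : Matrix (Fin 4) (Fin 4) F} {e f e' f' : Fin 4 → F}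
    (h : Symplectic c e f e' f') (v : Fin 4 → F) :
    v = bl c v f • e + bl c v e • f + (bl c v f' • e' + bl c v e' • f') := by
  have h1 := h.swap
  have := eq_sum_of_dual c ![e, f, e', f'] ![f, e, f', e'] (by
    intro i j
    fin_cases i <;> fin_cases j <;>
    simp [h.ef, h.ef', h.ee', h.e_f', h.fe', h.ff', h1.ee', h1.e_f', h1.fe', h1.ff',
      h.flip.ef, h1.flip.ef, bl_self_eq_zero]) rfl v
  simpa [Fin.sum_univ_four, add_assoc] using this

theorem eq_zero_of_qf_eq_mul {b d u v : F} (hc : Aniso (tauMat b d u v)) (z₀ z₁ : Fin 4 → F)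
    (h₁ : bl (tauMat b d u v) z₀ z₁ = qf (tauMat b d u v) z₀)
    (h₂ : qf (tauMat b d u v) z₁ = d * qf (tauMat b d u v) z₀) : z₀ = 0 := by
  by_contra hz
  set c := tauMat b d u v with hcdef
  have hz' : qf c z₀ ≠ 0 := fun h => hz (hc _ h)
  have hu : u ≠ 0 := by
    rintro rfl
    have := congrFun (hc ![1, 0, 0, 0] (by simp [hcdef, qf_tauMat])) 0
    simp at this
  have hv : v ≠ 0 := by
    rintro rfl
    have := congrFun (hc ![0, 0, 1, 0] (by simp [hcdef, qf_tauMat])) 2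
    simp at this
  have h2 : (2 : F) = 0 := CharTwo.two_eq_zero
  have hs : Symplectic c ![1, 0, 0, 0] ![0, u⁻¹, 0, 0] ![0, 0, 1, 0] ![0, 0, 0, v⁻¹] := by
    constructor <;> simp [hcdef, bl_tauMat, hu, hv]
  have hcomb := hs.eq_combination z₀
  have hne := hz
  rw [hcomb] at hne
  obtain ⟨f₁, -, e₁', -, f₁', -, hs₁, ω, hω⟩ := hs.exists_of_ne_zero hne ⊤ trivial trivial trivial trivial
  rw [← hcomb] at hs₁ hω
  have hcomb' := hs₁.eq_combination ((qf c z₀)⁻¹ • z₁)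
  rw [bl_smul_left c _ z₁ z₀, bl_comm c z₁ z₀, h₁, inv_mul_cancel₀ hz', one_smul] at hcomb'
  obtain ⟨e₂, -, f₂, -, hs₂, ω', hω'⟩ :=
    hs₁.exists_of_bl_eq_one (x := _) (x' := _) (y' := _) ⊤ trivial trivial trivial
  rw [← hcomb', qf_smul, h₂, hω] at hω'
  apply hc.mul_ne_artinSchreier hs₂.ef' (ω + ω')
  have h3 : qf c ![1, 0, 0, 0] * qf c ![0, u⁻¹, 0, 0] = b := by
    simp [hcdef, qf_tauMat]; field_simp
  have h4 : qf c ![0, 0, 1, 0] * qf c ![0, 0, 0, v⁻¹] = b + d := by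
    simp [hcdef, qf_tauMat]; field_simp
  have h5 : qf c z₀ * ((qf c z₀)⁻¹ ^ 2 * (d * qf c z₀)) = d := by field_simp
  rw [h3, h4, h5] at hω'
  linear_combination hω' + (b - ω * ω') * h2

end NormalForm

end Char2Quadrics

namespace Char2Quadrics

open Matrix

section AlbertNormalForm
variable {F : Type*} [Field F] [CharP F 2] {ι : Type*} [Fintype ι]

/-- The vectors orthogonal to two given ones. -/
def orthPair (c : Matrix ι ι F) (e f : ι → F) : Submodule F (ι → F) where
  carrier := {z | bl c z e = 0 ∧ bl c z f = 0}
  add_mem' := by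
    rintro a b ⟨h1, h2⟩ ⟨h3, h4⟩
    exact ⟨by rw [bl_add_left, h1, h3, add_zero], by rw [bl_add_left, h2, h4, add_zero]⟩
  zero_mem' := ⟨bl_zero_left _ _, bl_zero_left _ _⟩
  smul_mem' := by
    rintro a z ⟨h1, h2⟩
    exact ⟨by rw [bl_smul_left, h1, mul_zero], by rw [bl_smul_left, h2, mul_zero]⟩

/-- An anisotropic six-dimensional form with trivial Arf invariant representing `1` is of the shape
`[1,d] ⊥ u[1,b] ⊥ v[1,b+d]`. -/
theorem exists_albertMat_of_symplectic [DecidableEq ι] (hι : Fintype.card ι = 6)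
    {c : Matrix ι ι F} (hc : Aniso c)
    {e₀ f₀ e₁ f₁ e₂ f₂ : ι → F} (h01 : Symplectic c e₀ f₀ e₁ f₁) (h02 : Symplectic c e₀ f₀ e₂ f₂)
    (h12 : Symplectic c e₁ f₁ e₂ f₂)
    {ω : F} (harf : qf c e₀ * qf c f₀ + qf c e₁ * qf c f₁ + qf c e₂ * qf c f₂ = ω ^ 2 + ω)
    {v₀ : ι → F} (hv₀ : qf c v₀ = 1) {x₀ y₀ x₁ y₁ x₂ y₂ : F}
    (hv : v₀ = x₀ • e₀ + y₀ • f₀ + (x₁ • e₁ + y₁ • f₁) + (x₂ • e₂ + y₂ • f₂)) :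
    ∃ (b d u v : F) (P : Matrix ι (Fin 2 ⊕ Fin 4) F) (P' : Matrix (Fin 2 ⊕ Fin 4) ι F),
      P' * P = 1 ∧ P * P' = 1 ∧
      ∀ z, qf c (P *ᵥ z) = qf (albertMat d (tauMat b d u v)) z := by
  have h2 : (2 : F) = 0 := CharTwo.two_eq_zero
  obtain ⟨e, f, e', f', x, y, hef, he2, h'2, ⟨ω₁, hω₁⟩, hsum⟩ : ∃ (e f e' f' : ι → F) (x y : F),
      Symplectic c e f e' f' ∧ Symplectic c e f e₂ f₂ ∧ Symplectic c e' f' e₂ f₂ ∧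
      ArfCongr c e₀ f₀ e₁ f₁ e f e' f' ∧
      x₀ • e₀ + y₀ • f₀ + (x₁ • e₁ + y₁ • f₁) = x • e + y • f := by
    by_cases h0 : x₀ • e₀ + y₀ • f₀ + (x₁ • e₁ + y₁ • f₁) = 0
    · exact ⟨e₀, f₀, e₁, f₁, 0, 0, h01, h02, h12, ⟨0, by ring⟩, by simpa using h0⟩
    · have he₀ : e₀ ∈ orthPair c e₂ f₂ := ⟨h02.ee', h02.e_f'⟩
      have hf₀ : f₀ ∈ orthPair c e₂ f₂ := ⟨h02.fe', h02.ff'⟩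
      have he₁ : e₁ ∈ orthPair c e₂ f₂ := ⟨h12.ee', h12.e_f'⟩
      have hf₁ : f₁ ∈ orthPair c e₂ f₂ := ⟨h12.fe', h12.ff'⟩
      obtain ⟨f, hf, e', he', f', hf', hs, ha⟩ :=
        h01.exists_of_ne_zero h0 (orthPair c e₂ f₂) he₀ hf₀ he₁ hf₁
      have he : x₀ • e₀ + y₀ • f₀ + (x₁ • e₁ + y₁ • f₁) ∈ orthPair c e₂ f₂ :=
        add_mem (add_mem (Submodule.smul_mem _ _ he₀) (Submodule.smul_mem _ _ hf₀))
          (add_mem (Submodule.smul_mem _ _ he₁) (Submodule.smul_mem _ _ hf₁))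
      exact ⟨_, f, e', f', 1, 0, hs, ⟨hs.ef, h02.ef', he.1, he.2, hf.1, hf.2⟩,
        ⟨hs.ef', h02.ef', he'.1, he'.2, hf'.1, hf'.2⟩, ha, by simp⟩
  rw [hsum] at hv
  have hv0 : x • e + y • f + (x₂ • e₂ + y₂ • f₂) ≠ 0 := by
    rw [← hv]; rintro rfl; simp at hv₀
  obtain ⟨g, hg, e'', he'', f'', hf'', hs, ω₂, hω₂⟩ :=
    he2.exists_of_ne_zero hv0 (orthPair c e' f') ⟨hef.ee', hef.e_f'⟩ ⟨hef.fe', hef.ff'⟩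
      ⟨h'2.swap.ee', h'2.swap.e_f'⟩ ⟨h'2.swap.fe', h'2.swap.ff'⟩
  rw [← hv] at hs hω₂
  have hv₀' : Symplectic c v₀ g e' f' := by
    have : v₀ ∈ orthPair c e' f' := by
      rw [hv]
      exact add_mem (add_mem (Submodule.smul_mem _ _ ⟨hef.ee', hef.e_f'⟩)
        (Submodule.smul_mem _ _ ⟨hef.fe', hef.ff'⟩))
        (add_mem (Submodule.smul_mem _ _ ⟨h'2.swap.ee', h'2.swap.e_f'⟩)
        (Submodule.smul_mem _ _ ⟨h'2.swap.fe', h'2.swap.ff'⟩))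
    exact ⟨hs.ef, hef.ef', this.1, this.2, hg.1, hg.2⟩
  have h'' : Symplectic c e' f' e'' f'' :=
    Symplectic.swap ⟨hs.ef', hef.ef', he''.1, he''.2, hf''.1, hf''.2⟩
  have hα {e f e' f' : ι → F} (h : Symplectic c e f e' f') : qf c e' ≠ 0 := by
    intro h0
    have := h.ef'
    rw [hc _ h0, bl_zero_left] at this
    exact zero_ne_one this
  have hα₁ := hα hv₀'
  have hα₂ := hα hs
  have key : qf c g + qf c e' * qf c f' + qf c e'' * qf c f'' =
      (ω + ω₁ + ω₂) ^ 2 + (ω + ω₁ + ω₂) := by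
    rw [hv₀] at hω₂
    linear_combination hω₂ + hω₁ + harf - (ω * ω₁ + ω * ω₂ + ω₁ * ω₂) * h2
  generalize ω + ω₁ + ω₂ = η at key
  have hg' := (hv₀'.replace_pairs (x := 1) (y := 0) (z := η) (w := 1) (x' := 1) (y' := 0)
    (z' := 0) (w' := 1) (by simp [hs.ef, bl_add_right, bl_smul_right, bl_self_eq_zero])
    (by simp [hv₀'.ef']))
  have hg'' := (hs.replace_pairs (x := 1) (y := 0) (z := η) (w := 1) (x' := 1) (y' := 0)
    (z' := 0) (w' := 1) (by simp [hs.ef, bl_add_right, bl_smul_right, bl_self_eq_zero])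
    (by simp [hs.ef']))
  simp only [one_smul, zero_smul, add_zero, zero_add] at hg' hg''
  have hqg : qf c (η • v₀ + g) = qf c e' * qf c f' + qf c e'' * qf c f'' := by
    rw [qf_add, qf_smul, bl_smul_left, hs.ef, hv₀]
    linear_combination key + (η ^ 2 + η - qf c e' * qf c f' - qf c e'' * qf c f'') * h2
  generalize η • v₀ + g = h at hg' hg'' hqg
  have s1 := hg'.swap
  have s2 := hg''.swap
  have s3 := h''.swap
  obtain ⟨P', h1, h1'⟩ := exists_inverse_of_dual c
    (Sum.elim ![v₀, h] ![e', qf c e' • f', e'', qf c e'' • f''] : Fin 2 ⊕ Fin 4 → ι → F)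
    (Sum.elim ![h, v₀] ![f', (qf c e')⁻¹ • e', f'', (qf c e'')⁻¹ • e'']) (by
      rintro (i | i) (j | j) <;> fin_cases i <;> fin_cases j <;>
      simp [bl_smul_left, bl_smul_right, bl_self_eq_zero, hg'.ef, hg'.ef', hg'.ee', hg'.e_f',
        hg'.fe', hg'.ff', hg''.ef', hg''.ee', hg''.e_f', hg''.fe', hg''.ff', h''.ee', h''.e_f',
        h''.fe', h''.ff', s1.ee', s1.e_f', s1.fe', s1.ff', s2.ee', s2.e_f', s2.fe', s2.ff',
        s3.ee', s3.e_f', s3.fe', s3.ff', hg'.flip.ef, s1.flip.ef, s2.flip.ef, hα₁, hα₂]) (by simp [hι])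
  refine ⟨qf c e' * qf c f', qf c e' * qf c f' + qf c e'' * qf c f'', qf c e', qf c e'', _, P', h1,
    h1', fun z => ?_⟩
  have hP : (of (Sum.elim ![v₀, h] ![e', qf c e' • f', e'', qf c e'' • f''] :
      Fin 2 ⊕ Fin 4 → ι → F))ᵀ *ᵥ z = z (.inl 0) • v₀ + z (.inl 1) • h +
      (z (.inr 0) • e' + (z (.inr 1) * qf c e') • f' +
        (z (.inr 2) • e'' + (z (.inr 3) * qf c e'') • f'')) := by
    funext i
    simp [mulVec, dotProduct, Fin.sum_univ_four]
    ring
  rw [hP, qf_albertMat, qf_tauMat]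
  simp only [qf_add, bl_add_left, bl_add_right, qf_smul, bl_smul_left, bl_smul_right, hg'.ef,
    hg'.ef', hg'.ee', hg'.e_f', hg'.fe', hg'.ff', hg''.ef', hg''.ee', hg''.e_f', hg''.fe', hg''.ff',
    h''.ee', h''.e_f', h''.fe', h''.ff', hv₀, hqg, Function.comp]
  grind

end AlbertNormalForm

end Char2Quadrics

namespace Char2Quadrics

open Matrix QuadraticMap

section Coordinates
variable {F : Type} [Field F] {n : ℕ}

/-- The upper triangular matrix with given diagonal and given entries above it. -/
def upperMat {R : Type*} [CommRing R] (D : Fin n → R) (U : Fin n → Fin n → R) :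
    Matrix (Fin n) (Fin n) R :=
  fun i j => if i = j then D i else if i < j then U i j else 0

lemma qf_upperMat {R : Type*} [CommRing R] (D : Fin n → R) (U : Fin n → Fin n → R)
    (z : Fin n → R) : qf (upperMat D U) z =
      ∑ i, D i * z i ^ 2 + ∑ i, ∑ j ∈ Finset.univ.filter (fun j => i < j), U i j * z i * z j := by
  simp only [qf, dotProduct, mulVec, upperMat, ← Finset.sum_add_distrib, Finset.sum_filter]
  refine Finset.sum_congr rfl fun i _ => ?_
  have : ∀ j, (if i = j then D i else if i < j then U i j else 0) * z j =
      (if i = j then D i * z i else 0) + if i < j then U i j * z j else 0 := by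
    intro j
    by_cases h : i = j
    · subst h; simp
    · simp [h]
  simp only [this, Finset.sum_add_distrib, Finset.sum_ite_eq, Finset.mem_univ, if_true, mul_add,
    Finset.mul_sum]
  congr 1
  · ring
  · refine Finset.sum_congr rfl fun j _ => ?_
    split_ifs <;> ring

/-- The upper triangular matrix of a quadratic form on `Fⁿ`. -/
def formMat (q : QuadraticForm F (Fin n → F)) : Matrix (Fin n) (Fin n) F :=
  upperMat (fun i => q (Pi.single i 1)) fun i j => polar q (Pi.single i 1) (Pi.single j 1)

lemma formMat_map {R : Type*} [CommRing R] (φ : F →+* R) (q : QuadraticForm F (Fin n → F)) :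
    (formMat q).map φ = upperMat (fun i => φ (q (Pi.single i 1)))
      fun i j => φ (polar q (Pi.single i 1) (Pi.single j 1)) := by
  ext i j
  simp only [formMat, upperMat, Matrix.map_apply]
  split_ifs <;> simp

lemma baseChangeFin_apply (q : QuadraticForm F (Fin n → F)) (K : Type) [Field K] [Algebra F K]
    (z : Fin n → K) : baseChangeFin q K z = qf ((formMat q).map (algebraMap F K)) z := by
  rw [formMat_map, qf_upperMat]
  simp [baseChangeFin, Algebra.smul_def, mul_assoc, pow_two]

lemma qPoly_eq (q : QuadraticForm F (Fin n → F)) :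
    qPoly q = qf ((formMat q).map (MvPolynomial.C : F →+* MvPolynomial (Fin n) F))
      MvPolynomial.X := by
  rw [formMat_map, qf_upperMat]
  rfl

lemma quadraticForm_apply (q : QuadraticForm F (Fin n → F)) (z : Fin n → F) :
    q z = qf (formMat q) z := by
  obtain ⟨B, hB, hBe⟩ : ∃ B : (Fin n → F) →ₗ[F] (Fin n → F) →ₗ[F] F, B z z = q z ∧
      ∀ i j, B (Pi.single i 1) (Pi.single j 1) = formMat q i j := by
    refine ⟨q.toBilin (Pi.basisFun F (Fin n)), ?_, fun i j => ?_⟩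
    · exact congrArg (fun Q => Q z) (toQuadraticMap_toBilin q (Pi.basisFun F (Fin n)))
    · simpa [formMat, upperMat] using QuadraticMap.toBilin_apply q (Pi.basisFun F (Fin n)) i j
  have hz : z = ∑ i, z i • Pi.single i (1 : F) := by
    conv_lhs => rw [← (Pi.basisFun F (Fin n)).sum_repr z]
    simp only [Pi.basisFun_apply, Pi.basisFun_repr]
  rw [← hB]
  conv_lhs => rw [hz]
  simp only [LinearMap.map_sum₂, LinearMap.map_smul₂]
  simp only [map_sum, map_smul, hBe, smul_eq_mul, qf, dotProduct, mulVec, Finset.mul_sum]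
  refine Finset.sum_congr rfl fun i _ => Finset.sum_congr rfl fun j _ => ?_
  ring

lemma polar_apply (q : QuadraticForm F (Fin n → F)) (z w : Fin n → F) :
    polar q z w = bl (formMat q) z w := by
  simp only [polar, quadraticForm_apply, qf_add]
  ring

lemma qf_single {R ι : Type*} [CommRing R] [Fintype ι] [DecidableEq ι] (c : Matrix ι ι R) (i : ι) :
    qf c (Pi.single i 1) = c i i := by
  simp [qf]

lemma bl_single {R ι : Type*} [CommRing R] [Fintype ι] [DecidableEq ι] (c : Matrix ι ι R)
    (i j : ι) : bl c (Pi.single i 1) (Pi.single j 1) = c i j + c j i := by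
  simp [bl]

lemma qf_map_congr {R ι : Type*} [CommRing R] [Fintype ι] [DecidableEq ι]
    {c c' : Matrix ι ι F} (h : ∀ z, qf c z = qf c' z) (φ : F →+* R) (z : ι → R) :
    qf (c.map φ) z = qf (c'.map φ) z := by
  have hbl : ∀ z w, bl c z w = bl c' z w := by
    intro z w
    have := h (z + w)
    rw [qf_add, qf_add, h, h] at this
    exact add_left_cancel this
  have hd : ∀ i, c i i = c' i i := fun i => by simpa [qf_single] using h (Pi.single i 1)
  have ho : ∀ i j, c i j + c j i = c' i j + c' j i := fun i j => by
    simpa [bl_single] using hbl (Pi.single i 1) (Pi.single j 1)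
  simp only [qf, dotProduct, mulVec, Matrix.map_apply, Finset.mul_sum]
  rw [← sub_eq_zero, ← Finset.sum_sub_distrib]
  simp only [← Finset.sum_sub_distrib]
  rw [← Finset.sum_product']
  refine Finset.sum_involution (fun p _ => (p.2, p.1)) ?_ ?_ ?_ ?_
  · rintro ⟨i, j⟩ _
    have := congrArg φ (ho i j)
    simp only [map_add] at this
    linear_combination z i * z j * this
  · rintro ⟨i, j⟩ _ hne heq
    simp only [Prod.mk.injEq] at heq
    obtain ⟨rfl, -⟩ := heq
    exact hne (by simp [hd])
  · simp
  · simp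

lemma qf_conj {R ι κ : Type*} [CommRing R] [Fintype ι] [Fintype κ] (c : Matrix ι ι R)
    (P : Matrix ι κ R) (z : κ → R) : qf (Pᵀ * c * P) z = qf c (P *ᵥ z) := by
  simp [qf, ← Matrix.mulVec_mulVec, Matrix.dotProduct_mulVec, Matrix.vecMul_transpose]

lemma qf_map_mulVec {R ι κ : Type*} [CommRing R] [Fintype ι] [Fintype κ] [DecidableEq κ]
    {c : Matrix ι ι F} {P : Matrix ι κ F} {c' : Matrix κ κ F}
    (h : ∀ z, qf c (P *ᵥ z) = qf c' z) (φ : F →+* R) (z : κ → R) :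
    qf (c.map φ) (P.map φ *ᵥ z) = qf (c'.map φ) z := by
  rw [← qf_conj, ← Matrix.transpose_map, ← Matrix.map_mul, ← Matrix.map_mul]
  exact qf_map_congr (fun z => by rw [qf_conj, h]) φ z

end Coordinates

end Char2Quadrics

namespace Char2Quadrics

open Matrix QuadraticMap

section NormalForm
variable {F : Type} [Field F]

lemma sumBin_apply {ι : Type} [Fintype ι] (a b : ι → F) (w : ι → F × F) :
    sumBin F a b w = ∑ i, a i * ((w i).1 ^ 2 + (w i).1 * (w i).2 + b i * (w i).2 ^ 2) := by
  simp [sumBin, binForm, pow_two]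

lemma polar_sumBin [CharP F 2] {ι : Type} [Fintype ι] (a b : ι → F) (w w' : ι → F × F) :
    polar (sumBin F a b) w w' =
      ∑ i, a i * ((w i).1 * (w' i).2 + (w i).2 * (w' i).1) := by
  have h2 : (2 : F) = 0 := CharTwo.two_eq_zero
  simp only [polar, sumBin_apply, ← Finset.sum_sub_distrib, Pi.add_apply, Prod.fst_add,
    Prod.snd_add]
  refine Finset.sum_congr rfl fun i _ => ?_
  linear_combination (a i * ((w i).1 * (w' i).1 + b i * (w i).2 * (w' i).2)) * h2

/-- The normal form of an anisotropic Albert form representing `1`. -/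
theorem exists_albertMat [CharP F 2] {q : QuadraticForm F (Fin 6 → F)} (halb : IsAlbert q)
    (hrep : Represents q 1) (han : q.Anisotropic) :
    ∃ (b d u v : F) (P : Matrix (Fin 6) (Fin 2 ⊕ Fin 4) F) (P' : Matrix (Fin 2 ⊕ Fin 4) (Fin 6) F),
      P' * P = 1 ∧ P * P' = 1 ∧
      ∀ z, qf (formMat q) (P *ᵥ z) = qf (albertMat d (tauMat b d u v)) z := by
  obtain ⟨v₀, hv₀, -⟩ := hrep
  obtain ⟨-, -, m, a, b, ha, ⟨iso⟩, ω, hω⟩ := halb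
  obtain rfl : m = 3 := by
    have := iso.toLinearEquiv.finrank_eq
    rw [Module.finrank_fin_fun, Module.finrank_pi_fintype] at this
    simp at this
    omega
  set e : Fin 3 → Fin 6 → F := fun i => iso.symm (Pi.single i (1, 0))
  set f : Fin 3 → Fin 6 → F := fun i => iso.symm (Pi.single i (0, (a i)⁻¹))
  have hbl : ∀ s t, bl (formMat q) (iso.symm s) (iso.symm t) = polar (sumBin F a b) s t := by
    intro s t
    rw [← polar_apply]
    simp only [polar, ← map_add, iso.symm.map_app]
  have hqf : ∀ s, qf (formMat q) (iso.symm s) = sumBin F a b s := by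
    intro s
    rw [← quadraticForm_apply, iso.symm.map_app]
  have hS : ∀ i j, i ≠ j → Symplectic (formMat q) (e i) (f i) (e j) (f j) := by
    intro i j hij
    constructor <;> simp only [e, f, hbl, polar_sumBin]
    all_goals
      fin_cases i <;> fin_cases j <;> simp [Fin.sum_univ_three, ha] at hij ⊢
  have hqe : ∀ i, qf (formMat q) (e i) = a i := by
    intro i
    simp only [e, hqf, sumBin_apply]
    fin_cases i <;> simp [Fin.sum_univ_three]
  have hqf' : ∀ i, qf (formMat q) (f i) = b i * (a i)⁻¹ := by
    intro i
    have := ha i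
    simp only [f, hqf, sumBin_apply]
    fin_cases i <;> simp [Fin.sum_univ_three] at this ⊢ <;> field_simp
  refine exists_albertMat_of_symplectic (ω := ω) (by simp)
    (fun z hz => han z (by rw [quadraticForm_apply, hz]))
    (hS 0 1 (by decide)) (hS 0 2 (by decide)) (hS 1 2 (by decide)) ?_
    (v₀ := v₀) (x₀ := (iso v₀ 0).1) (y₀ := a 0 * (iso v₀ 0).2) (x₁ := (iso v₀ 1).1)
    (y₁ := a 1 * (iso v₀ 1).2) (x₂ := (iso v₀ 2).1) (y₂ := a 2 * (iso v₀ 2).2)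
    (by rw [← quadraticForm_apply, hv₀]) ?_
  · have h2 : (2 : F) = 0 := CharTwo.two_eq_zero
    simp only [hqe, hqf', mul_left_comm (a _) (b _), mul_inv_cancel₀ (ha _), mul_one]
    rw [Fin.sum_univ_three] at hω
    linear_combination hω - ω * h2
  · apply iso.toLinearEquiv.injective
    have he : ∀ i, iso.toLinearEquiv (e i) = Pi.single i (1, 0) :=
      fun i => iso.apply_symm_apply _
    have hf : ∀ i, iso.toLinearEquiv (f i) = Pi.single i (0, (a i)⁻¹) :=
      fun i => iso.apply_symm_apply _
    have hv : iso.toLinearEquiv v₀ = iso v₀ := rfl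
    simp only [map_add, map_smul, he, hf, hv]
    ext i <;> fin_cases i <;> simp [mul_right_comm, ha]

end NormalForm

end Char2Quadrics

namespace Char2Quadrics

open Matrix Polynomial

section PolynomialDescent
variable {L : Type*} [Field L] [CharP L 2]

omit [CharP L 2] in
lemma natDegree_one_add_X_add {d : L} (hd : d ≠ 0) :
    (1 + X + C d * X ^ 2 : L[X]).natDegree = 2 := by
  compute_degree!

/-- If `q = [1,d] ⊥ τ` and `τ` are anisotropic, then `τ` takes no nonzero value divisible by
`1 + X + d X²` on vectors of polynomials of degree at most `1`. -/
lemma eq_zero_of_dvd_qf {b d u v : L} (hτ : Aniso (tauMat b d u v)) (hd : d ≠ 0)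
    {ρ : Fin 4 → L[X]} (hρ : ∀ i, (ρ i).natDegree ≤ 1)
    (h : (1 + X + C d * X ^ 2) ∣ qf ((tauMat b d u v).map C) ρ) : ρ = 0 := by
  obtain ⟨e, he⟩ := h
  have hA := natDegree_one_add_X_add hd
  have hA0 : (1 + X + C d * X ^ 2 : L[X]) ≠ 0 := by
    intro h0; rw [h0] at hA; simp at hA
  obtain ⟨e₀, rfl⟩ : ∃ e₀, e = C e₀ := by
    by_cases he0 : e = 0
    · exact ⟨0, by simp [he0]⟩
    · refine ⟨_, eq_C_of_natDegree_eq_zero ?_⟩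
      have := natDegree_qf_le (tauMat b d u v) hρ
      rw [he, natDegree_mul hA0 he0, hA] at this
      omega
  set ρ₀ : Fin 4 → L := fun i => (ρ i).coeff 0
  set ρ₁ : Fin 4 → L := fun i => (ρ i).coeff 1
  have hρe : ρ = C ∘ ρ₀ + (X : L[X]) • (C ∘ ρ₁) := by
    ext1 i
    have := eq_X_add_C_of_natDegree_le_one (hρ i)
    simp only [Pi.add_apply, Pi.smul_apply, Function.comp_apply, smul_eq_mul, ρ₀, ρ₁]
    conv_lhs => rw [this]
    ring
  have key : C (qf (tauMat b d u v) ρ₀) + X ^ 2 * C (qf (tauMat b d u v) ρ₁) +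
      X * C (bl (tauMat b d u v) ρ₀ ρ₁) = (1 + X + C d * X ^ 2) * C e₀ := by
    rw [← he, hρe, qf_add, qf_smul, qf_map, qf_map, bl_smul_right, bl_map]
  have k0 := congrArg (fun p => p.coeff 0) key
  have k1 := congrArg (fun p => p.coeff 1) key
  have k2 := congrArg (fun p => p.coeff 2) key
  simp [coeff_X, coeff_one, coeff_X_pow] at k0 k1 k2
  have h0 : ρ₀ = 0 := eq_zero_of_qf_eq_mul hτ ρ₀ ρ₁ (by rw [k1, k0]) (by rw [k2, k0])
  have h1 : ρ₁ = 0 := by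
    apply hτ
    rw [k2, ← k0, h0, qf_zero, mul_zero]
  rw [hρe, h0, h1]
  ext1 i
  simp

lemma eq_zero_of_qf_eq_mul_qf {b d u v : L} (hτ : Aniso (tauMat b d u v)) (hd : d ≠ 0) (n : ℕ) :
    ∀ z z' : Fin 4 → L[X], (∀ i, (z i).natDegree ≤ n) →
      qf ((tauMat b d u v).map C) z = (1 + X + C d * X ^ 2) * qf ((tauMat b d u v).map C) z' →
      z = 0 ∧ z' = 0 := by
  have hA := natDegree_one_add_X_add hd
  have hA0 : (1 + X + C d * X ^ 2 : L[X]) ≠ 0 := by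
    intro h0; rw [h0] at hA; simp at hA
  have hτ' : Aniso ((tauMat b d u v).map C) := hτ.map_C
  suffices H : ∀ z z' : Fin 4 → L[X], (∀ i, (z i).natDegree ≤ n) →
      qf ((tauMat b d u v).map C) z = (1 + X + C d * X ^ 2) * qf ((tauMat b d u v).map C) z' →
      z' = 0 by
    intro z z' hz h
    have := H z z' hz h
    refine ⟨hτ' z ?_, this⟩
    rw [h, this, qf_zero, mul_zero]
  induction n with
  | zero =>
    intro z z' hz h
    apply hτ'
    by_contra h0
    have := natDegree_qf_le (tauMat b d u v) hz
    rw [h, natDegree_mul hA0 h0, hA] at this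
    omega
  | succ n ih =>
    intro z z' hz h
    by_contra hz'
    have h0 : qf ((tauMat b d u v).map C) z' ≠ 0 := fun h0 => hz' (hτ' _ h0)
    have hdeg := natDegree_qf_le (tauMat b d u v) hz
    rw [h, natDegree_mul hA0 h0, hA] at hdeg
    have hz'n := natDegree_le_of_natDegree_qf_le (n := n) hτ (z := z') (by omega)
    set w : Fin 4 → L[X] := fun i => z i / (1 + X + C d * X ^ 2)
    set ρ : Fin 4 → L[X] := fun i => z i % (1 + X + C d * X ^ 2)
    have hzρ : z = ρ + (1 + X + C d * X ^ 2 : L[X]) • w := by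
      ext1 i
      exact (EuclideanDomain.mod_add_div (z i) _).symm
    have hρ : ρ = 0 := by
      refine eq_zero_of_dvd_qf hτ hd (fun i => ?_) ?_
      · have := natDegree_mod_lt (z i) (q := 1 + X + C d * X ^ 2) (by omega)
        change (z i % _).natDegree ≤ 1
        omega
      · rw [hzρ, qf_add, qf_smul, bl_comm, bl_smul_left] at h
        refine ⟨qf ((tauMat b d u v).map C) z' - (1 + X + C d * X ^ 2) *
          qf ((tauMat b d u v).map C) w - bl ((tauMat b d u v).map C) w ρ, ?_⟩
        linear_combination h
    rw [hzρ, hρ, zero_add, qf_smul, pow_two, mul_assoc] at h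
    have hw := mul_left_cancel₀ hA0 h
    rw [ih _ _ hz'n hw.symm, qf_zero, mul_zero] at hw
    exact h0 hw.symm

end PolynomialDescent

end Char2Quadrics

namespace Char2Quadrics

open Matrix Polynomial IntermediateField

section PolynomialDescent
variable {F K : Type*} [Field F] [Field K] [Algebra F K] {ι : Type*} [Fintype ι]

lemma Aniso.anisoOver_adjoin_empty {c : Matrix ι ι F} (hc : Aniso c) :
    AnisoOver (adjoin F (∅ : Set K)) (c.map (algebraMap F K)) := by
  intro z hz h
  have : ∀ i, ∃ w, algebraMap F K w = z i := by
    intro i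
    have := hz i
    rw [adjoin_empty, mem_bot] at this
    exact this
  choose w hw using this
  obtain rfl : algebraMap F K ∘ w = z := funext hw
  rw [qf_map] at h
  rw [hc w ((algebraMap F K).injective (by rw [h, map_zero]))]
  ext1 i
  simp

theorem AnisoOver.doubleMat [CharP K 2] {S : Set K} {t : K}
    (ht : Transcendental (adjoin F S) t) {b d u v : K} (hb : b ∈ adjoin F S) (hd : d ∈ adjoin F S)
    (hu : u ∈ adjoin F S) (hv : v ∈ adjoin F S) (hd0 : d ≠ 0)
    (h : AnisoOver (adjoin F S) (tauMat b d u v)) :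
    AnisoOver (adjoin F (insert t S)) (doubleMat (1 + t + d * t ^ 2) (tauMat b d u v)) := by
  have : CharP (adjoin F S) 2 :=
    (algebraMap (adjoin F S) K).charP (algebraMap (adjoin F S) K).injective 2
  lift b to adjoin F S using hb
  lift d to adjoin F S using hd
  lift u to adjoin F S using hu
  lift v to adjoin F S using hv
  have hmap : tauMat (b : K) d u v = (tauMat b d u v).map (algebraMap (adjoin F S) K) := by
    rw [tauMat_map]; rfl
  rw [hmap] at h ⊢
  have hτ := Aniso.of_anisoOver h
  have hd0' : d ≠ 0 := fun h0 => hd0 (by simp [h0])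
  intro z hz h0
  obtain ⟨f, g, hg, hf⟩ := exists_common_denom S ht z hz
  have hg' : aeval t g ≠ 0 := fun h0 => hg ((transcendental_iff.mp ht) g h0)
  set e : (adjoin F S)[X] →+* K := (aeval t : (adjoin F S)[X] →ₐ[adjoin F S] K).toRingHom with he
  have heinj : Function.Injective e := by
    rw [injective_iff_map_eq_zero]
    exact fun p hp => (transcendental_iff.mp ht) p hp
  have hfl : e ∘ (f ∘ Sum.inl) = e g • (z ∘ Sum.inl) := by
    funext i; simpa [he] using hf (.inl i)
  have hfr : e ∘ (f ∘ Sum.inr) = e g • (z ∘ Sum.inr) := by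
    funext i; simpa [he] using hf (.inr i)
  obtain ⟨h1, h2⟩ := eq_zero_of_qf_eq_mul_qf hτ hd0'
    (Finset.univ.sup fun i => ((f ∘ Sum.inl) i).natDegree) (f ∘ Sum.inl) (f ∘ Sum.inr)
    (fun i => Finset.le_sup (f := fun i => ((f ∘ Sum.inl) i).natDegree) (Finset.mem_univ i)) (by
      apply heinj
      rw [map_mul, ← qf_map, ← qf_map, hfl, hfr, map_C_map_aeval, qf_smul, qf_smul]
      rw [qf_doubleMat] at h0
      have hA : e (1 + X + C d * X ^ 2) = 1 + t + d * t ^ 2 := by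
        simp [he]
      rw [hA, CharTwo.add_eq_zero.mp h0]
      ring)
  ext1 (i | i)
  · have := hf (.inl i)
    rw [show f (.inl i) = 0 from congrFun h1 i] at this
    simpa [hg'] using this
  · have := hf (.inr i)
    rw [show f (.inr i) = 0 from congrFun h2 i] at this
    simpa [hg'] using this

end PolynomialDescent

end Char2Quadrics

namespace Char2Quadrics

open Matrix IntermediateField

section Descent
variable {F K : Type} [Field F] [Field K] [Algebra F K] [CharP K 2]

/-- The field generated by the first `k` members of a family. -/
def initialField (F : Type) {K : Type} [Field F] [Field K] [Algebra F K] {n : ℕ} (p : Fin n → K)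
    (k : ℕ) : IntermediateField F K :=
  adjoin F (p '' {j | j.val < k})

omit [CharP K 2] in
lemma initialField_succ {n : ℕ} (p : Fin n → K) (k : Fin n) :
    initialField F p (k + 1) = adjoin F (insert (p k) (p '' {j | j.val < k})) := by
  rw [initialField, ← Set.image_insert_eq]
  congr 2
  ext j
  simp only [Set.mem_ofPred_eq, Set.mem_insert_iff, Fin.ext_iff]
  omega

omit [CharP K 2] in
lemma mem_initialField {n : ℕ} (p : Fin n → K) {k : ℕ} {j : Fin n} (h : j.val < k) :
    p j ∈ initialField F p k :=
  subset_adjoin _ _ ⟨j, h, rfl⟩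

omit [CharP K 2] in
lemma transcendental_initialField {n : ℕ} {p : Fin n → K} (hp : AlgebraicIndependent F p)
    (k : Fin n) : Transcendental (initialField F p k) (p k) :=
  transcendental_adjoin_image hp (by simp)

omit [CharP K 2] in
lemma AnisoOver.initialField {ι : Type*} [Fintype ι] {n : ℕ} {p : Fin n → K}
    (hp : AlgebraicIndependent F p) {c : Matrix ι ι K} {m : ℕ}
    (hc : ∀ i j, c i j ∈ initialField F p m) (h : AnisoOver (initialField F p m) c)
    {k : ℕ} (hmk : m ≤ k) (hk : k ≤ n) : AnisoOver (Char2Quadrics.initialField F p k) c := by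
  induction k, hmk using Nat.le_induction with
  | base => exact h
  | succ k hmk ih =>
    have hle : Char2Quadrics.initialField F p m ≤ Char2Quadrics.initialField F p k :=
      adjoin.mono _ _ _ (Set.image_mono fun j hj => lt_of_lt_of_le hj hmk)
    have := initialField_succ (F := F) p ⟨k, hk⟩
    simp only at this
    rw [this]
    exact AnisoOver.adjoin_insert (transcendental_initialField hp ⟨k, hk⟩)
      (fun i j => hle (hc i j)) (ih (by omega))

end Descent

end Char2Quadrics

namespace Char2Quadrics

open Matrix IntermediateField

section QuadraticExtension
variable {F K : Type} [Field F] [Field K] [Algebra F K] [CharP K 2]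

/-- A vector orthogonal to the isotropic vector `(s, st, x)` of `[1,d] ⊥ τ` on which the form takes
the value `1` yields an isotropic vector of `τ ⊥ aτ`, where `a = 1 + t + d t²`. -/
lemma exists_qf_doubleMat_eq_zero {b d u v s t a : K} (hs : s ≠ 0) (ht : t ≠ 0)
    (ha : a = 1 + t + d * t ^ 2) {x : Fin 4 → K} (hx : qf (tauMat b d u v) x = s ^ 2 * a)
    (ha0 : a ≠ 0) {h : Fin 2 ⊕ Fin 4 → K} (hq : qf (albertMat d (tauMat b d u v)) h = 1)
    (hb : bl (albertMat d (tauMat b d u v)) h (Sum.elim ![s, s * t] x) = 0) :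
    ∃ z, z ≠ 0 ∧ qf (doubleMat a (tauMat b d u v)) z = 0 := by
  have h2 : (2 : K) = 0 := CharTwo.two_eq_zero
  set τ := tauMat b d u v with hτ
  set h₀ := h (.inl 0)
  set m := h (.inl 1) / t with hm
  have hmt : h (.inl 1) = m * t := by rw [hm]; field_simp
  set h₁ := h ∘ Sum.inr with hh₁
  rw [qf_albertMat, hmt] at hq
  rw [bl_albertMat, hmt, Sum.elim_comp_inr] at hb
  simp only [Sum.elim_inl, cons_val_zero, cons_val_one] at hb
  change h₀ ^ 2 + h₀ * (m * t) + d * (m * t) ^ 2 + qf τ h₁ = 1 at hq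
  change 2 * h₀ * s + h₀ * (s * t) + m * t * s + 2 * d * (m * t) * (s * t) + bl τ h₁ x = 0 at hb
  have hb' : bl τ h₁ x = s * (h₀ * t + m * t) := by
    linear_combination hb - (h₀ * s + d * m * t * s * t + s * h₀ * t + s * m * t) * h2
  have hq' : qf τ h₁ = 1 + h₀ ^ 2 + h₀ * m * t + d * m ^ 2 * t ^ 2 := by
    linear_combination hq - (h₀ ^ 2 + h₀ * m * t + d * m ^ 2 * t ^ 2) * h2
  refine ⟨Sum.elim (((1 + h₀ + m) / s) • x) ((m / s) • x + h₁), ?_, ?_⟩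
  · intro h0
    have hl : ((1 + h₀ + m) / s) • x = 0 := by
      simpa using congrArg (fun z => z ∘ Sum.inl) h0
    have hr : (m / s) • x + h₁ = 0 := by
      simpa using congrArg (fun z => z ∘ Sum.inr) h0
    have hx0 : x ≠ 0 := by
      rintro rfl
      rw [qf_zero] at hx
      exact mul_ne_zero (pow_ne_zero 2 hs) ha0 hx.symm
    have hlam : (1 + h₀ + m) / s = 0 := (smul_eq_zero.mp hl).resolve_right hx0
    have hlam' : 1 + h₀ + m = 0 := by
      simpa [hs] using hlam
    have hh : bl τ h₁ x = 0 := by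
      have h3 : bl τ ((m / s) • x + h₁) x = 0 := by rw [hr, bl_zero_left]
      rw [bl_add_left, bl_smul_left, bl_self, h2] at h3
      simpa using h3
    rw [hb', ← add_mul] at hh
    have h4 : h₀ + m = 0 := by simpa [hs, ht] using hh
    rw [add_assoc, h4, add_zero] at hlam'
    exact one_ne_zero hlam'
  · rw [qf_doubleMat, Sum.elim_comp_inl, Sum.elim_comp_inr, qf_add, qf_smul, qf_smul,
      bl_smul_left, bl_comm, hb', hq', hx, ha]
    field_simp
    grind

/-- If a form over `M` becomes isotropic over the quadratic extension `K = M(s)`, split the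
isotropic vector into its components. -/
lemma exists_qf_eq_add_of_isotropic (M : IntermediateField F K) {b d u v s t a : K}
    (hbM : b ∈ M) (hdM : d ∈ M) (huM : u ∈ M) (hvM : v ∈ M) (htM : t ∈ M) (ht : t ≠ 0)
    (hu : u ≠ 0) (hs : s ∉ M) (hK : ∀ z, ∃ α ∈ M, ∃ β ∈ M, z = α + β * s)
    (ha : a = 1 + t + d * t ^ 2) {x : Fin 4 → K} (hxM : ∀ i, x i ∈ M)
    (hx : qf (tauMat b d u v) x = s ^ 2 * a) (ha0 : a ≠ 0)
    (han : AnisoOver M (doubleMat a (tauMat b d u v)))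
    {z : Fin 4 ⊕ Fin 4 → K} (hz : z ≠ 0) (hqz : qf (doubleMat a (tauMat b d u v)) z = 0) :
    ∃ z, (∀ i, z i ∈ M) ∧
      qf (doubleMat a (tauMat b d u v)) z = a + qf (tauMat b d u v) x := by
  have hs0 : s ≠ 0 := fun h => hs (h ▸ M.zero_mem)
  have haM : a ∈ M := by
    rw [ha]
    exact M.add_mem (M.add_mem M.one_mem htM) (M.mul_mem hdM (pow_mem htM 2))
  have : CharP M 2 := (algebraMap M K).charP (algebraMap M K).injective 2
  lift b to M using hbM
  lift d to M using hdM
  lift u to M using huM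
  lift v to M using hvM
  lift t to M using htM
  lift a to M using haM
  obtain ⟨x, rfl⟩ := exists_lift M hxM
  have hτ : tauMat (b : K) d u v = (tauMat b d u v).map (algebraMap M K) := by
    rw [tauMat_map]; rfl
  have hσ : doubleMat (a : K) (tauMat (b : K) d u v) =
      (doubleMat a (tauMat b d u v)).map (algebraMap M K) := by
    rw [doubleMat_map, hτ]; rfl
  rw [hτ, qf_map] at hx
  rw [hσ] at han hqz ⊢
  rw [hτ, qf_map]
  have hK' : ∀ i, ∃ α β : M, z i = α + β * s := by
    intro i
    obtain ⟨α, hα, β, hβ, h⟩ := hK (z i)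
    exact ⟨⟨α, hα⟩, ⟨β, hβ⟩, h⟩
  choose α β hαβ using hK'
  have hzαβ : z = algebraMap M K ∘ α + s • (algebraMap M K ∘ β) := by
    ext1 i
    rw [hαβ i]
    simp [mul_comm]
  rw [hzαβ, qf_add, qf_smul, bl_smul_right, qf_map, qf_map, bl_map] at hqz
  have hT : algebraMap M K (a * qf (doubleMat a (tauMat b d u v)) α +
      qf (tauMat b d u v) x * qf (doubleMat a (tauMat b d u v)) β) +
      s * algebraMap M K (a * bl (doubleMat a (tauMat b d u v)) α β) = 0 := by
    rw [map_add, map_mul, map_mul, map_mul, hx]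
    change (a : K) * _ + s ^ 2 * a * _ + s * (a * _) = 0
    linear_combination (a : K) * hqz
  have hbl : a * bl (doubleMat a (tauMat b d u v)) α β = 0 := by
    by_contra hne
    apply hs
    obtain ⟨r, hr⟩ : ∃ r : M, s = algebraMap M K r := by
      refine ⟨-(a * qf (doubleMat a (tauMat b d u v)) α +
        qf (tauMat b d u v) x * qf (doubleMat a (tauMat b d u v)) β) /
        (a * bl (doubleMat a (tauMat b d u v)) α β), ?_⟩
      have hne' : algebraMap M K (a * bl (doubleMat a (tauMat b d u v)) α β) ≠ 0 := by
        simpa using hne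
      rw [map_div₀, eq_div_iff hne', map_neg]
      linear_combination hT
    rw [hr]
    exact r.2
  rw [hbl, map_zero, mul_zero, add_zero, map_eq_zero] at hT
  have ha0' : a ≠ 0 := fun h => ha0 (by simp [h])
  obtain ⟨w, hw⟩ := exists_doubleMat_eq_add (b := b) (d := d) (u := u) (v := v) (t := t) (a := a)
    (fun h => ht (by simp [h])) (fun h => hu (by simp [h])) (Subtype.ext (by simpa using ha))
    ha0' (Aniso.of_anisoOver han) x
    (by
      intro h0
      rw [h0, map_zero] at hx
      exact mul_ne_zero (pow_ne_zero 2 hs0) ha0 hx.symm) α β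
    (by
      by_contra! hne
      apply hz
      rw [hzαβ, hne.1, hne.2]
      ext1 i; simp)
    ((mul_eq_zero.mp hbl).resolve_left ha0') (CharTwo.add_eq_zero.mp hT)
  refine ⟨algebraMap M K ∘ w, fun i => (w i).2, ?_⟩
  rw [qf_map, hw, map_add]
  rfl

end QuadraticExtension

end Char2Quadrics

namespace Char2Quadrics

open Matrix IntermediateField

section Specialization
variable {F K : Type} [Field F] [Field K] [Algebra F K] [CharP K 2]

/-- Specializing the transcendental coordinates of a represented element to zero, one by one. -/
lemma exists_qf_eq_of_generic {m : ℕ} {p : Fin (m + 1) → K} (hp : AlgebraicIndependent F p)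
    {κ : Type*} [Fintype κ] {c : Matrix (Fin m ⊕ κ) (Fin m ⊕ κ) K}
    (hc : ∀ i j, c i j ∈ initialField F p 1) (han : AnisoOver (initialField F p 1) c)
    {a : K} (ha : a ∈ initialField F p 1) {z : Fin m ⊕ κ → K}
    (hz : ∀ i, z i ∈ initialField F p (m + 1))
    (hqz : qf c z = a + qf c (Sum.elim (p ∘ Fin.succ) 0)) :
    ∃ z, (∀ i, z i ∈ initialField F p 1) ∧ qf c z = a ∧
      ∀ i, bl c z (Sum.elim (Pi.single i 1) 0) = 0 := by
  set X : ℕ → Fin m ⊕ κ → K := fun k => Sum.elim (fun i => if i.val < k then p i.succ else 0) 0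
  set J : ℕ → Set (Fin m ⊕ κ → K) :=
    fun k => (fun i => Sum.elim (Pi.single i 1) 0) '' {i : Fin m | k ≤ i.val}
  have hmem : ∀ i : Fin m, ∀ L : IntermediateField F K, ∀ j,
      (Sum.elim (Pi.single i 1) 0 : Fin m ⊕ κ → K) j ∈ L := by
    rintro i L (j | j)
    · by_cases hij : j = i
      · subst hij; simp
      · simp [hij]
    · simp
  have key : ∀ k ≤ m, ∃ z, (∀ i, z i ∈ initialField F p (k + 1)) ∧ qf c z = a + qf c (X k) ∧
      ∀ w ∈ J k, bl c z w = bl c (X k) w := by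
    intro k hk
    induction hk using Nat.decreasingInduction with
    | self =>
      refine ⟨z, hz, ?_, ?_⟩
      · rw [hqz]
        congr 3
        ext1 i
        simp
      · rintro w ⟨i, hi, rfl⟩
        exact absurd i.2 (not_lt.mpr hi)
    | of_succ k hk ih =>
      have hle : initialField F p 1 ≤ initialField F p (k + 1) :=
        adjoin.mono _ _ _ (Set.image_mono fun j (hj : j.val < 1) => by
          change j.val < k + 1
          omega)
      have hX : X (k + 1) = X k + p (Fin.succ ⟨k, hk⟩) •
          (Sum.elim (Pi.single ⟨k, hk⟩ 1) 0 : Fin m ⊕ κ → K) := by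
        ext1 (i | i)
        · rcases lt_trichotomy i.val k with h | h | h
          · simp [X, h, h.trans, Fin.ext_iff, h.ne]
          · obtain rfl : i = ⟨k, hk⟩ := Fin.ext h
            simp [X]
          · simp [X, h.not_gt, Fin.ext_iff, h.ne', Nat.not_lt.mpr (Nat.succ_le_of_lt h)]
        · simp [X]
      have hJ : J k = insert (Sum.elim (Pi.single ⟨k, hk⟩ 1) 0) (J (k + 1)) := by
        simp only [J]
        rw [← Set.image_insert_eq (f := fun i => (Sum.elim (Pi.single i 1) 0 : Fin m ⊕ κ → K))]
        congr 1
        ext i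
        simp only [Set.mem_ofPred_eq, Set.mem_insert_iff, Fin.ext_iff]
        omega
      have hs := initialField_succ (F := F) p (Fin.succ ⟨k, hk⟩)
      simp only [Fin.val_succ] at hs
      rw [hX, hs] at ih
      rw [hJ]
      have han' : AnisoOver (initialField F p (k + 1)) c :=
        AnisoOver.initialField hp hc han (by omega) (by omega)
      refine exists_specialization_adjoin (transcendental_initialField hp (Fin.succ ⟨k, hk⟩))
        (fun i j => hle (hc i j)) han' (hle ha) ?_ (hmem _ _) ?_ ih
      · rintro (i | i)
        · by_cases h : i.val < k
          · simp only [X, Sum.elim_inl, h, if_true]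
            exact mem_initialField p (Nat.succ_lt_succ h)
          · simp [X, h]
        · simp [X]
      · rintro w ⟨i, -, rfl⟩
        exact hmem _ _
  obtain ⟨z, hz, hqz, hJz⟩ := key 0 (Nat.zero_le m)
  have hX0 : X 0 = 0 := by
    ext1 (i | i) <;> simp [X]
  rw [hX0, qf_zero, add_zero] at hqz
  refine ⟨z, hz, hqz, fun i => ?_⟩
  rw [hJz _ ⟨i, by simp, rfl⟩, hX0, bl_zero_left]

end Specialization

section Contradiction
variable {F K : Type} [Field F] [CharP F 2] [Field K] [Algebra F K]

/-- Over the function field of the quadric of an anisotropic form `[1,d] ⊥ τ`, presented as a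
quadratic extension of a purely transcendental one, no vector orthogonal to the generic
isotropic vector has value `1`. -/
theorem bl_ne_zero_of_qf_eq_one {b d u v : F} (han : Aniso (albertMat d (tauMat b d u v)))
    {p : Fin 5 → K} (hp : AlgebraicIndependent F p) {s : K} (hs : s ≠ 0)
    (hK : ∀ z, ∃ α ∈ initialField F p 5, ∃ β ∈ initialField F p 5, z = α + β * s)
    (hx : qf ((tauMat b d u v).map (algebraMap F K)) (p ∘ Fin.succ) =
      s ^ 2 * (1 + p 0 + algebraMap F K d * p 0 ^ 2)) {h : Fin 2 ⊕ Fin 4 → K}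
    (hq : qf ((albertMat d (tauMat b d u v)).map (algebraMap F K)) h = 1) :
    bl ((albertMat d (tauMat b d u v)).map (algebraMap F K)) h
      (Sum.elim ![s, s * p 0] (p ∘ Fin.succ)) ≠ 0 := by
  intro hb
  have : CharP K 2 := charP_of_injective_ringHom (algebraMap F K).injective 2
  have hτ : Aniso (tauMat b d u v) := by
    intro z hz
    have := han (Sum.elim 0 z) (by simp [qf_albertMat, hz])
    simpa using congrArg (fun z => z ∘ Sum.inr) this
  have hd : d ≠ 0 := by
    rintro rfl
    have := han (Sum.elim ![0, 1] 0) (by simp [qf_albertMat])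
    simpa using congrFun this (.inl 1)
  have hu : u ≠ 0 := by
    rintro rfl
    have := hτ ![1, 0, 0, 0] (by simp [qf_tauMat])
    simpa using congrFun this 0
  have hv : v ≠ 0 := by
    rintro rfl
    have := hτ ![0, 0, 1, 0] (by simp [qf_tauMat])
    simpa using congrFun this 2
  have hF : ∀ (k : ℕ) (f : F), algebraMap F K f ∈ initialField F p k :=
    fun k f => IntermediateField.algebraMap_mem _ f
  have hempty : ∀ {ι : Type} [Fintype ι] {c : Matrix ι ι F}, Aniso c →
      AnisoOver (initialField F p 0) (c.map (algebraMap F K)) := by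
    intro ι _ c hc
    have : initialField F p 0 = adjoin F (∅ : Set K) := by
      rw [initialField]
      congr 1
      simp
    rw [this]
    exact hc.anisoOver_adjoin_empty
  have hA : ∀ k ≤ 5, AnisoOver (initialField F p k)
      ((albertMat d (tauMat b d u v)).map (algebraMap F K)) := fun k hk =>
    AnisoOver.initialField hp (fun i j => hF _ _) (hempty han) (Nat.zero_le k) hk
  have hsM : s ∉ initialField F p 5 := by
    intro hsM
    have := hA 5 le_rfl (Sum.elim ![s, s * p 0] (p ∘ Fin.succ)) (by
      rintro (i | i)
      · have := mul_mem hsM (mem_initialField (F := F) p (j := 0) (k := 5) (by simp))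
        fin_cases i <;> simpa
      · exact mem_initialField p (Fin.isLt _)) (by
        rw [albertMat_map, qf_albertMat, Sum.elim_comp_inr, hx]
        simp only [Sum.elim_inl, cons_val_zero, cons_val_one]
        linear_combination (s ^ 2 * (1 + p 0 + algebraMap F K d * p 0 ^ 2)) *
          (CharTwo.two_eq_zero : (2 : K) = 0))
    exact hs (by simpa using congrFun this (.inl 0))
  have h01 : initialField F p 1 = adjoin F (insert (p 0) (p '' {j | j.val < 0})) :=
    initialField_succ p 0
  rw [albertMat_map, tauMat_map] at hq hb hA
  rw [tauMat_map] at hx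
  have hu' : algebraMap F K u ≠ 0 := by simpa
  have hv' : algebraMap F K v ≠ 0 := by simpa
  set a := 1 + p 0 + algebraMap F K d * p 0 ^ 2 with ha
  set τ := tauMat (algebraMap F K b) (algebraMap F K d) (algebraMap F K u) (algebraMap F K v)
    with hτK
  have hσ1 : AnisoOver (initialField F p 1) (doubleMat a τ) := by
    have h0 := hempty hτ
    rw [tauMat_map] at h0
    rw [h01]
    exact AnisoOver.doubleMat (transcendental_initialField hp 0) (hF 0 b) (hF 0 d) (hF 0 u)
      (hF 0 v) (by simpa) h0
  have ht1 : p 0 ∈ initialField F p 1 := mem_initialField p (by simp)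
  have ha1 : a ∈ initialField F p 1 :=
    add_mem (add_mem (one_mem _) ht1) (mul_mem (hF _ _) (pow_mem ht1 2))
  have hτ1 : ∀ i j, τ i j ∈ initialField F p 1 := by
    intro i j
    rw [hτK, ← tauMat_map]
    exact hF _ _
  have hσm : ∀ i j, doubleMat a τ i j ∈ initialField F p 1 := by
    rintro (i | i) (j | j)
    · exact hτ1 i j
    · exact zero_mem _
    · exact zero_mem _
    · exact mul_mem ha1 (hτ1 i j)
  have hσ5 : AnisoOver (initialField F p 5) (doubleMat a τ) :=
    AnisoOver.initialField hp hσm hσ1 (by simp) le_rfl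
  have ha0 : a ≠ 0 := by
    intro ha0
    have := hσ1 (Sum.elim 0 ![1, 0, 0, 0]) (by
      rintro (i | i)
      · simp
      · fin_cases i <;> simp) (by simp [qf_doubleMat, ha0])
    simpa using congrFun this (.inr 0)
  have ht0 : p 0 ≠ 0 := hp.ne_zero 0
  obtain ⟨z, hz0, hqz⟩ := exists_qf_doubleMat_eq_zero hs ht0 ha hx ha0 hq hb
  obtain ⟨z, hz, hqz⟩ := exists_qf_eq_add_of_isotropic (x := p ∘ Fin.succ)
    (initialField F p 5) (hF 5 b) (hF 5 d)
    (hF 5 u) (hF 5 v) (mem_initialField p (by simp)) ht0 hu' hsM hK ha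
    (fun i => mem_initialField p (Fin.isLt _)) hx ha0 hσ5 hz0 hqz
  obtain ⟨z, hz, hqz, hbz⟩ := exists_qf_eq_of_generic hp hσm hσ1 ha1 hz
    (by rw [hqz, qf_doubleMat, Sum.elim_comp_inl, Sum.elim_comp_inr, qf_zero, mul_zero, add_zero])
  have hl : z ∘ Sum.inl = 0 := by
    have h2 : (2 : K) = 0 := CharTwo.two_eq_zero
    simp only [bl_doubleMat, Sum.elim_comp_inl, Sum.elim_comp_inr, bl_comm _ _ (0 : Fin 4 → K),
      bl_zero_left, mul_zero, add_zero, hτK, bl_tauMat, h2] at hbz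
    have z0 := hbz 0
    have z1 := hbz 1
    have z2 := hbz 2
    have z3 := hbz 3
    simp [hu', hv'] at z0 z1 z2 z3
    ext1 i
    fin_cases i <;> simpa
  rw [qf_doubleMat, hl, qf_zero, zero_add] at hqz
  have hqz1 : qf τ (z ∘ Sum.inr) = 1 := mul_left_cancel₀ ha0 (by rw [hqz, mul_one])
  have := hA 1 (by simp) (Sum.elim ![1, 0] (z ∘ Sum.inr)) (by
    rintro (i | i)
    · fin_cases i <;> simp
    · exact hz _) (by
      rw [qf_albertMat, Sum.elim_comp_inr, hqz1]
      simp only [Sum.elim_inl, cons_val_zero, cons_val_one]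
      linear_combination (CharTwo.two_eq_zero : (2 : K) = 0))
  simpa using congrFun this (.inl 0)

end Contradiction

end Char2Quadrics

namespace Char2Quadrics

open Matrix

section Isotropic
variable {K : Type*} [Field K] [CharP K 2] {ι : Type*} [Fintype ι]

/-- Moving a vector of value `1` orthogonal to one isotropic vector to one orthogonal to another. -/
lemma exists_orthogonal_of_bl_ne_zero {c : Matrix ι ι K} {y z s : ι → K} (hy : qf c y = 0)
    (hz : qf c z = 0) (hyz : bl c y z ≠ 0) (hs : qf c s = 1) (hsy : bl c s y = 0) :
    ∃ h, qf c h = 1 ∧ bl c h z = 0 := by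
  have h2 : (2 : K) = 0 := CharTwo.two_eq_zero
  have hzz : bl c z z = 0 := by rw [bl_self, hz, mul_zero]
  refine ⟨s + (bl c s z / bl c y z) • (y + z), ?_, ?_⟩
  · rw [qf_add, qf_smul, qf_add, bl_smul_right, bl_add_right, hs, hy, hz, hsy]
    field_simp
    linear_combination bl c y z * bl c s z ^ 2 * h2
  · rw [bl_add_left, bl_smul_left, bl_add_left, hzz]
    field_simp
    linear_combination bl c s z * bl c y z * h2

lemma exists_orthogonal_of_isotropic {c : Matrix ι ι K} (hc : ∀ z ≠ 0, ∃ w, bl c z w ≠ 0)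
    {y z s : ι → K} (hy : qf c y = 0) (hz : qf c z = 0) (hy0 : y ≠ 0) (hz0 : z ≠ 0)
    (hs : qf c s = 1) (hsy : bl c s y = 0) : ∃ h, qf c h = 1 ∧ bl c h z = 0 := by
  by_cases hyz : bl c y z = 0
  · obtain ⟨w, hwy, hwz⟩ : ∃ w, bl c y w ≠ 0 ∧ bl c z w ≠ 0 := by
      obtain ⟨w₁, h₁⟩ := hc y hy0
      obtain ⟨w₂, h₂⟩ := hc z hz0
      by_cases h₁z : bl c z w₁ = 0
      · by_cases h₂y : bl c y w₂ = 0
        · exact ⟨w₁ + w₂, by rwa [bl_add_right, h₂y, add_zero],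
            by rwa [bl_add_right, h₁z, zero_add]⟩
        · exact ⟨w₂, h₂y, h₂⟩
      · exact ⟨w₁, h₁, h₁z⟩
    have hzz : bl c z z = 0 := by rw [bl_self, hz, mul_zero]
    have hg : qf c (w + (qf c w / bl c z w) • z) = 0 := by
      rw [qf_add, qf_smul, hz, bl_smul_right, bl_comm c w z, div_mul_cancel₀ _ hwz, mul_zero,
        add_zero, CharTwo.add_self_eq_zero]
    obtain ⟨h, hh, hhg⟩ := exists_orthogonal_of_bl_ne_zero hy hg
      (by rwa [bl_add_right, bl_smul_right, hyz, mul_zero, add_zero]) hs hsy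
    refine exists_orthogonal_of_bl_ne_zero hg hz ?_ hh hhg
    rwa [bl_add_left, bl_smul_left, hzz, mul_zero, add_zero, bl_comm]
  · exact exists_orthogonal_of_bl_ne_zero hy hz hyz hs hsy

lemma exists_bl_albertMat_ne_zero {b d u v : K} (hu : u ≠ 0) (hv : v ≠ 0) :
    ∀ z ≠ 0, ∃ w, bl (albertMat d (tauMat b d u v)) z w ≠ 0 := by
  intro z hz
  by_contra! h
  apply hz
  have h2 : (2 : K) = 0 := CharTwo.two_eq_zero
  have h0 := h (Sum.elim ![0, 1] 0)
  have h1 := h (Sum.elim ![1, 0] 0)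
  have h3 := fun i => h (Sum.elim 0 (Pi.single i 1))
  simp only [bl_albertMat, Sum.elim_comp_inr, bl_tauMat, h2] at h0 h1 h3
  have z0 := h3 0
  have z1 := h3 1
  have z2 := h3 2
  have z3 := h3 3
  simp [hu, hv] at h0 h1 z0 z1 z2 z3
  ext1 (i | i) <;> fin_cases i <;> simpa

end Isotropic

section FractionFields
variable {F A K : Type*} [Field F] [CommRing A] [Algebra F A] [Field K] [Algebra A K] [Algebra F K]
  [IsScalarTower F A K]

/-- Algebraic independence of a ratio and further elements can be checked on a specialization. -/
lemma algebraicIndependent_div (hA : Function.Injective (algebraMap A K)) {Ω : Type*} [Field Ω]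
    [Algebra F Ω] (χ : A →ₐ[F] Ω) {n : ℕ} (c₀ c₁ : A) (c : Fin n → A) {T : Fin (n + 1) → Ω}
    (hT : AlgebraicIndependent F T) (h₀ : χ c₀ ≠ 0) (h₁ : χ c₁ = χ c₀ * T 0)
    (hc : ∀ i, χ (c i) = T i.succ) :
    AlgebraicIndependent F
      (Fin.cons (algebraMap A K c₁ / algebraMap A K c₀) (algebraMap A K ∘ c) : Fin (n + 1) → K) := by
  set p : Fin (n + 1) → K := Fin.cons (algebraMap A K c₁ / algebraMap A K c₀) (algebraMap A K ∘ c)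
  have hc₀ : algebraMap A K c₀ ≠ 0 := by
    intro h
    rw [hA (h.trans (map_zero _).symm), map_zero] at h₀
    exact h₀ rfl
  have key : ∀ P : MvPolynomial (Fin (n + 1)) F, ∃ (N : ℕ) (Q : A),
      algebraMap A K Q = algebraMap A K c₀ ^ N * MvPolynomial.aeval p P ∧
      χ Q = χ c₀ ^ N * MvPolynomial.aeval T P := by
    intro P
    induction P using MvPolynomial.induction_on with
    | C f => exact ⟨0, algebraMap F A f, by simp [← IsScalarTower.algebraMap_apply], by simp⟩
    | add P₁ P₂ ih₁ ih₂ =>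
      obtain ⟨N₁, Q₁, h₁, h₁'⟩ := ih₁
      obtain ⟨N₂, Q₂, h₂, h₂'⟩ := ih₂
      refine ⟨N₁ + N₂, c₀ ^ N₂ * Q₁ + c₀ ^ N₁ * Q₂, ?_, ?_⟩
      · simp only [map_add, map_mul, map_pow, h₁, h₂]; ring
      · simp only [map_add, map_mul, map_pow, h₁', h₂']; ring
    | mul_X P i ih =>
      obtain ⟨N, Q, h, h'⟩ := ih
      refine Fin.cases ⟨N + 1, Q * c₁, ?_, ?_⟩ (fun i => ⟨N, Q * c i, ?_, ?_⟩) i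
      · simp only [map_mul, h, MvPolynomial.aeval_X, p, Fin.cons_zero]
        field_simp
        ring
      · simp only [map_mul, h', h₁, MvPolynomial.aeval_X]
        ring
      · simp only [map_mul, h, MvPolynomial.aeval_X, p, Fin.cons_succ, Function.comp_apply]
        ring
      · simp only [map_mul, h', hc, MvPolynomial.aeval_X]
        ring
  rw [algebraicIndependent_iff]
  intro P hP
  obtain ⟨N, Q, h, h'⟩ := key P
  rw [hP, mul_zero] at h
  rw [hA (h.trans (map_zero _).symm), map_zero] at h'
  exact (algebraicIndependent_iff.mp hT) P
    ((mul_eq_zero.mp h'.symm).resolve_left (pow_ne_zero N h₀))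

/-- In characteristic two, a field generated by elements of `M + M s` with `s² ∈ M` is
`M + M s`. -/
lemma exists_eq_add_mul [CharP K 2] [IsFractionRing A K] {G : Set A} (hG : Algebra.adjoin F G = ⊤)
    (M : IntermediateField F K) {s : K} (hs : s ^ 2 ∈ M)
    (hGs : ∀ g ∈ G, ∃ α ∈ M, ∃ β ∈ M, algebraMap A K g = α + β * s) (z : K) :
    ∃ α ∈ M, ∃ β ∈ M, z = α + β * s := by
  have hmul : ∀ z w : K, (∃ α ∈ M, ∃ β ∈ M, z = α + β * s) → (∃ α ∈ M, ∃ β ∈ M, w = α + β * s) →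
      ∃ α ∈ M, ∃ β ∈ M, z * w = α + β * s := by
    rintro _ _ ⟨α, hα, β, hβ, rfl⟩ ⟨γ, hγ, δ, hδ, rfl⟩
    exact ⟨α * γ + β * δ * s ^ 2, add_mem (mul_mem hα hγ) (mul_mem (mul_mem hβ hδ) hs),
      α * δ + β * γ, add_mem (mul_mem hα hδ) (mul_mem hβ hγ), by ring⟩
  have hA : ∀ r : A, ∃ α ∈ M, ∃ β ∈ M, algebraMap A K r = α + β * s := by
    intro r
    have hr : r ∈ Algebra.adjoin F G := hG ▸ Algebra.mem_top
    induction hr using Algebra.adjoin_induction with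
    | mem x hx => exact hGs x hx
    | algebraMap f =>
      exact ⟨algebraMap F K f, M.algebraMap_mem f, 0, zero_mem _,
        by simp [← IsScalarTower.algebraMap_apply]⟩
    | add x y _ _ hx hy =>
      obtain ⟨α, hα, β, hβ, h₁⟩ := hx
      obtain ⟨γ, hγ, δ, hδ, h₂⟩ := hy
      exact ⟨α + γ, add_mem hα hγ, β + δ, add_mem hβ hδ, by rw [map_add, h₁, h₂]; ring⟩
    | mul x y _ _ hx hy => rw [map_mul]; exact hmul _ _ hx hy
  obtain ⟨r, r', hr', rfl⟩ := IsFractionRing.div_surjective (A := A) z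
  have hinv : ∃ α ∈ M, ∃ β ∈ M, (algebraMap A K r')⁻¹ = α + β * s := by
    obtain ⟨α, hα, β, hβ, h⟩ := hA r'
    have hsq : (algebraMap A K r') ^ 2 = α ^ 2 + β ^ 2 * s ^ 2 := by
      rw [h, CharTwo.add_sq, mul_pow]
    have hm : (algebraMap A K r') ^ 2 ∈ M := by
      rw [hsq]
      exact add_mem (pow_mem hα 2) (mul_mem (pow_mem hβ 2) hs)
    refine ⟨α * ((algebraMap A K r') ^ 2)⁻¹, mul_mem hα (inv_mem hm),
      β * ((algebraMap A K r') ^ 2)⁻¹, mul_mem hβ (inv_mem hm), ?_⟩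
    by_cases h0 : algebraMap A K r' = 0
    · simp [h0]
    · calc (algebraMap A K r')⁻¹ = algebraMap A K r' * ((algebraMap A K r') ^ 2)⁻¹ := by
            field_simp
        _ = _ := by rw [congrArg (· * _) h]; ring
  rw [div_eq_mul_inv]
  exact hmul _ _ (hA r) hinv

end FractionFields

end Char2Quadrics

namespace Char2Quadrics

open Matrix QuadraticMap

section GenericPoint
variable {F : Type} [Field F]

lemma aeval_ne_zero {Ω : Type*} [Field Ω] [Algebra F Ω] {n : ℕ} {T : Fin n → Ω}
    (hT : AlgebraicIndependent F T) {P : MvPolynomial (Fin n) F} (x : Fin n → F)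
    (hx : MvPolynomial.eval x P ≠ 0) : MvPolynomial.aeval T P ≠ 0 := by
  intro h
  rw [algebraicIndependent_iff.mp hT P h, map_zero] at hx
  exact hx rfl

lemma one_add_add_ne_zero {Ω : Type*} [Field Ω] [Algebra F Ω] {T : Fin 5 → Ω}
    (hT : AlgebraicIndependent F T) (d : F) : 1 + T 0 + algebraMap F Ω d * T 0 ^ 2 ≠ 0 := by
  have := aeval_ne_zero hT
    (P := 1 + MvPolynomial.X 0 + MvPolynomial.C d * MvPolynomial.X 0 ^ 2) 0 (by simp)
  simpa using this

/-- A zero of `q` with algebraically independent affine coordinates. -/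
lemma exists_generic_zero [CharP F 2] {b d u v : F} (hu : u ≠ 0) :
    ∃ (Ω : Type) (_ : Field Ω) (_ : Algebra F Ω) (T : Fin 5 → Ω) (s : Ω),
      AlgebraicIndependent F T ∧ s ≠ 0 ∧
      qf ((albertMat d (tauMat b d u v)).map (algebraMap F Ω))
        (Sum.elim ![s, s * T 0] (T ∘ Fin.succ)) = 0 := by
  let E := FractionRing (MvPolynomial (Fin 5) F)
  let Ω := AlgebraicClosure E
  let T : Fin 5 → Ω := fun i => algebraMap (MvPolynomial (Fin 5) F) Ω (MvPolynomial.X i)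
  have hT : AlgebraicIndependent F T := by
    have hinj : Function.Injective (algebraMap (MvPolynomial (Fin 5) F) Ω) := by
      rw [IsScalarTower.algebraMap_eq (MvPolynomial (Fin 5) F) E Ω]
      exact (algebraMap E Ω).injective.comp (IsFractionRing.injective _ _)
    exact (MvPolynomial.algebraicIndependent_X (Fin 5) F).map'
      (f := IsScalarTower.toAlgHom F (MvPolynomial (Fin 5) F) Ω) hinj
  have : CharP Ω 2 := charP_of_injective_ringHom (algebraMap F Ω).injective 2
  have ha := one_add_add_ne_zero hT d
  have hτ : qf ((tauMat b d u v).map (algebraMap F Ω)) (T ∘ Fin.succ) ≠ 0 := by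
    have := aeval_ne_zero hT
      (P := qf ((tauMat b d u v).map MvPolynomial.C) (MvPolynomial.X ∘ Fin.succ))
      ![0, 1, 0, 0, 0] (by rw [tauMat_map, qf_tauMat]; simp [hu])
    rw [tauMat_map, qf_tauMat] at this ⊢
    simpa using this
  obtain ⟨s, hs⟩ := IsAlgClosed.exists_pow_nat_eq
    (qf ((tauMat b d u v).map (algebraMap F Ω)) (T ∘ Fin.succ) /
      (1 + T 0 + algebraMap F Ω d * T 0 ^ 2)) (n := 2) (by norm_num)
  rw [eq_div_iff ha] at hs
  refine ⟨Ω, inferInstance, inferInstance, T, s, hT, ?_, ?_⟩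
  · rintro rfl
    exact hτ (by rw [← hs]; simp)
  · rw [albertMat_map, qf_albertMat, Sum.elim_comp_inr, ← hs]
    simp only [Sum.elim_inl, cons_val_zero, cons_val_one]
    linear_combination (s ^ 2 * (1 + T 0 + algebraMap F Ω d * T 0 ^ 2)) *
      (CharTwo.two_eq_zero : (2 : Ω) = 0)

end GenericPoint

section ConeRing
variable {F : Type} [Field F] {n : ℕ} (q : QuadraticForm F (Fin n → F))

/-- The coordinate functions on the affine cone. -/
noncomputable def coneCoord (i : Fin n) : coneRing q := Ideal.Quotient.mk _ (MvPolynomial.X i)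

lemma adjoin_range_coneCoord : Algebra.adjoin F (Set.range (coneCoord q)) = ⊤ := by
  have h : Set.range (coneCoord q) = Ideal.Quotient.mkₐ F (Ideal.span {qPoly q}) ''
      Set.range MvPolynomial.X := by
    rw [← Set.range_comp]
    rfl
  rw [h, ← AlgHom.map_adjoin, MvPolynomial.adjoin_range_X, Algebra.map_top]
  exact (AlgHom.range_eq_top _).mpr (Ideal.Quotient.mkₐ_surjective F _)

lemma qf_coneCoord : qf ((formMat q).map (algebraMap F (coneRing q))) (coneCoord q) = 0 := by
  have h : Ideal.Quotient.mk (Ideal.span {qPoly q}) (qPoly q) = 0 :=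
    Ideal.Quotient.eq_zero_iff_mem.mpr (Ideal.subset_span rfl)
  have hq := congrArg (Ideal.Quotient.mk (Ideal.span {qPoly q})) (qPoly_eq q)
  rw [← qf_map, Matrix.map_map, h] at hq
  exact hq.symm

variable {q} in
lemma exists_coneRing_algHom {Ω : Type*} [Field Ω] [Algebra F Ω] {y : Fin n → Ω}
    (hy : qf ((formMat q).map (algebraMap F Ω)) y = 0) :
    ∃ χ : coneRing q →ₐ[F] Ω, ∀ i, χ (coneCoord q i) = y i := by
  refine ⟨Ideal.Quotient.liftₐ _ (MvPolynomial.aeval y) ?_, fun i => ?_⟩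
  · intro a ha
    rw [Ideal.mem_span_singleton] at ha
    obtain ⟨r, rfl⟩ := ha
    have : MvPolynomial.aeval y (qPoly q) = 0 := by
      rw [qPoly_eq, ← hy]
      have := qf_map (MvPolynomial.aeval (R := F) y).toRingHom ((formMat q).map MvPolynomial.C)
        MvPolynomial.X
      refine this.symm.trans ?_
      have hC : (MvPolynomial.aeval (R := F) y).toRingHom ∘ MvPolynomial.C = algebraMap F Ω :=
        funext fun f => by simp
      have hX : (MvPolynomial.aeval (R := F) y).toRingHom ∘ MvPolynomial.X = y :=
        funext fun i => by simp
      rw [Matrix.map_map, hC, hX]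
    rw [map_mul, this, zero_mul]
  · exact MvPolynomial.aeval_X y i

end ConeRing

end Char2Quadrics

namespace Char2Quadrics

open Matrix QuadraticMap

section FunctionField

lemma exists_orthogonal_of_equivalent {K : Type} [Field K] {n m : ℕ} {c : Matrix (Fin n) (Fin n) K}
    {Q : QuadraticForm K (Fin n → K)} (hQ : ∀ z, Q z = qf c z) {q₁ : QuadraticForm K (Fin m → K)}
    (h : Equivalent Q (q₁.prod (hyperbolicPlane K))) (h1 : Represents q₁ 1) :
    ∃ s y, qf c s = 1 ∧ qf c y = 0 ∧ y ≠ 0 ∧ bl c s y = 0 := by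
  obtain ⟨iso⟩ := h
  obtain ⟨v, hv, -⟩ := h1
  have hq : ∀ w, qf c (iso.symm w) = q₁ w.1 + w.2.1 * w.2.2 := by
    intro w
    rw [← hQ, iso.symm.map_app]
    simp [hyperbolicPlane]
  refine ⟨iso.symm (v, 0), iso.symm (0, (1, 0)), by simp [hq, hv], by simp [hq], ?_, ?_⟩
  · intro h0
    have : ((0, (1, 0)) : (Fin m → K) × K × K) = 0 :=
      iso.symm.toLinearEquiv.injective (h0.trans (map_zero iso.symm.toLinearEquiv).symm)
    simp at this
  · have h1 := qf_add c (iso.symm (v, 0)) (iso.symm (0, (1, 0)))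
    have h2 : iso.symm (v, 0) + iso.symm (0, (1, 0)) = iso.symm (v, (1, 0)) := by
      have := (map_add iso.symm.toLinearEquiv (v, 0) ((0, (1, 0)) : (Fin m → K) × K × K)).symm
      simpa using this
    rw [h2] at h1
    simpa [hq] using h1

lemma ne_zero_of_aniso_albertMat {F : Type} [Field F] {b d u v : F}
    (h : Aniso (albertMat d (tauMat b d u v))) : u ≠ 0 ∧ v ≠ 0 := by
  constructor
  · rintro rfl
    simpa using congrFun (h (Sum.elim 0 ![1, 0, 0, 0]) (by simp [qf_albertMat, qf_tauMat])) (.inr 0)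
  · rintro rfl
    simpa using congrFun (h (Sum.elim 0 ![0, 0, 1, 0]) (by simp [qf_albertMat, qf_tauMat])) (.inr 2)

/-- The function field of an anisotropic Albert form, in the coordinates of the normal form. -/
lemma exists_functionField_coordinates {F : Type} [Field F] [CharP F 2]
    {q : QuadraticForm F (Fin 6 → F)} {b d u v : F} {P : Matrix (Fin 6) (Fin 2 ⊕ Fin 4) F}
    {P' : Matrix (Fin 2 ⊕ Fin 4) (Fin 6) F} (hP : P' * P = 1) (hP' : P * P' = 1)
    (hq : ∀ z, qf (formMat q) (P *ᵥ z) = qf (albertMat d (tauMat b d u v)) z) (hu : u ≠ 0)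
    (K : Type) [Field K] [Algebra (coneRing q) K] [IsFractionRing (coneRing q) K]
    [Algebra F K] [IsScalarTower F (coneRing q) K] :
    ∃ (p : Fin 5 → K) (s : K), AlgebraicIndependent F p ∧ s ≠ 0 ∧
      (∀ z, ∃ α ∈ initialField F p 5, ∃ β ∈ initialField F p 5, z = α + β * s) ∧
      qf ((tauMat b d u v).map (algebraMap F K)) (p ∘ Fin.succ) =
        s ^ 2 * (1 + p 0 + algebraMap F K d * p 0 ^ 2) := by
  have : CharP K 2 := charP_of_injective_ringHom (algebraMap F K).injective 2
  have hmap {R : Type} [CommRing R] [Algebra F R] :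
      P'.map (algebraMap F R) * P.map (algebraMap F R) = 1 ∧
      P.map (algebraMap F R) * P'.map (algebraMap F R) = 1 := by
    rw [← Matrix.map_mul, ← Matrix.map_mul, hP, hP']
    simp
  have hA : Function.Injective (algebraMap (coneRing q) K) := IsFractionRing.injective (coneRing q) K
  set c := P'.map (algebraMap F (coneRing q)) *ᵥ coneCoord q with hc
  have hPc : P.map (algebraMap F (coneRing q)) *ᵥ c = coneCoord q := by
    rw [hc, Matrix.mulVec_mulVec, hmap.2, Matrix.one_mulVec]
  have hqc : qf ((albertMat d (tauMat b d u v)).map (algebraMap F (coneRing q))) c = 0 := by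
    rw [← qf_map_mulVec hq, hPc, qf_coneCoord]
  obtain ⟨Ω, _, _, T, σ, hT, hσ, hz⟩ := exists_generic_zero (b := b) (d := d) (v := v) hu
  obtain ⟨χ, hχ⟩ := exists_coneRing_algHom
    (y := P.map (algebraMap F Ω) *ᵥ Sum.elim ![σ, σ * T 0] (T ∘ Fin.succ))
    (by rw [qf_map_mulVec hq, hz])
  have hχc : ∀ i, χ (c i) = Sum.elim ![σ, σ * T 0] (T ∘ Fin.succ) i := by
    have : χ ∘ c = Sum.elim ![σ, σ * T 0] (T ∘ Fin.succ) := by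
      rw [← Matrix.one_mulVec (Sum.elim _ _), ← hmap.1, ← Matrix.mulVec_mulVec, ← funext hχ]
      ext i
      simp [hc, mulVec, dotProduct]
    exact congrFun this
  have hp := algebraicIndependent_div hA χ (c (.inl 0)) (c (.inl 1)) (c ∘ Sum.inr) hT
    (by rw [hχc]; exact hσ) (by rw [hχc, hχc]; rfl) (fun i => hχc (.inr i))
  set s := algebraMap (coneRing q) K (c (.inl 0))
  set p : Fin 5 → K := Fin.cons (algebraMap (coneRing q) K (c (.inl 1)) / s) (algebraMap (coneRing q) K ∘ c ∘ Sum.inr)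
    with hpdef
  have hs : s ≠ 0 := by
    intro h
    have := hχc (.inl 0)
    rw [hA (h.trans (map_zero _).symm), map_zero] at this
    exact hσ this.symm
  have hcK : algebraMap (coneRing q) K ∘ c = Sum.elim ![s, s * p 0] (p ∘ Fin.succ) := by
    ext (i | i)
    · fin_cases i
      · rfl
      · simp [hpdef, mul_div_cancel₀ _ hs]
    · rfl
  have hx : qf ((tauMat b d u v).map (algebraMap F K)) (p ∘ Fin.succ) =
        s ^ 2 * (1 + p 0 + algebraMap F K d * p 0 ^ 2) := by
    have h := congrArg (algebraMap (coneRing q) K) hqc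
    rw [← qf_map, Matrix.map_map, ← RingHom.coe_comp, ← IsScalarTower.algebraMap_eq, hcK,
      albertMat_map, qf_albertMat, Sum.elim_comp_inr, map_zero] at h
    simp only [Sum.elim_inl, cons_val_zero, cons_val_one] at h
    linear_combination h - (s ^ 2 * (1 + p 0 + algebraMap F K d * p 0 ^ 2)) *
      (CharTwo.two_eq_zero : (2 : K) = 0)
  refine ⟨p, s, hp, hs, ?_, hx⟩
  set M := initialField F p 5
  have hpM : ∀ i, p i ∈ M := fun i => mem_initialField p i.isLt
  have ha := one_add_add_ne_zero hp d
  have hsM : s ^ 2 ∈ M := by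
    rw [eq_div_of_mul_eq ha hx.symm]
    refine div_mem ?_ (add_mem (add_mem (one_mem _) (hpM 0))
      (mul_mem (M.algebraMap_mem d) (pow_mem (hpM 0) 2)))
    simp only [qf, dotProduct, mulVec]
    exact sum_mem fun i _ => mul_mem (hpM _) (sum_mem fun j _ =>
      mul_mem (M.algebraMap_mem _) (hpM _))
  refine exists_eq_add_mul (adjoin_range_coneCoord q) M hsM ?_
  rintro _ ⟨i, rfl⟩
  choose α hα β hβ hαβ using show ∀ k, ∃ α ∈ M, ∃ β ∈ M, algebraMap (coneRing q) K (c k) = α + β * s by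
    intro k
    have hk : algebraMap (coneRing q) K (c k) = _ := congrFun hcK k
    rw [hk]
    rcases k with k | k
    · fin_cases k
      · exact ⟨0, zero_mem _, 1, one_mem _, by rw [zero_add, one_mul]; rfl⟩
      · exact ⟨0, zero_mem _, p 0, hpM 0, by rw [zero_add, mul_comm]; rfl⟩
    · exact ⟨p k.succ, hpM k.succ, 0, zero_mem _, by rw [zero_mul, add_zero]; rfl⟩
  refine ⟨∑ k, algebraMap F K (P i k) * α k,
    sum_mem fun k _ => mul_mem (M.algebraMap_mem _) (hα k),
    ∑ k, algebraMap F K (P i k) * β k,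
    sum_mem fun k _ => mul_mem (M.algebraMap_mem _) (hβ k), ?_⟩
  rw [← hPc, Finset.sum_mul, ← Finset.sum_add_distrib, mulVec, dotProduct, map_sum]
  refine Finset.sum_congr rfl fun k _ => ?_
  rw [map_mul, hαβ, Matrix.map_apply, ← IsScalarTower.algebraMap_apply]
  ring

end FunctionField

end Char2Quadrics

namespace Char2Quadrics

/-- Lemma 8.1 / `8p1temp`.
Let `F` be a field of characteristic 2 and let `q` be an Albert form over `F` which
represents 1. Let `F(q)` be the function field of the projective quadric defined by
`q` (realized as the fraction field `K` of the homogeneous coordinate ring of the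
quadric), and let `q₁` be a quadratic form over `F(q)` such that `q_{F(q)} ≅ q₁ ⊥ ℍ`,
where `ℍ` is the hyperbolic plane. If `q₁` represents 1, then `q` is isotropic
over `F`. -/
theorem statement_19 (F : Type) [Field F] [CharP F 2]
    (q : QuadraticForm F (Fin 6 → F))
    (halb : IsAlbert q) (hrep : Represents q 1)
    -- `K = F(q)`, the function field of the quadric defined by `q`:
    (K : Type) [Field K] [Algebra (coneRing q) K] [IsFractionRing (coneRing q) K]
    [Algebra F K] [IsScalarTower F (coneRing q) K]
    -- `q₁` is a form over `F(q)` with `q_{F(q)} ≅ q₁ ⊥ ℍ`: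
    (q₁ : QuadraticForm K (Fin 4 → K))
    (hdecomp : QuadraticMap.Equivalent (baseChangeFin q K)
      (q₁.prod (hyperbolicPlane K)))
    -- `q₁` represents 1:
    (h1 : Represents q₁ 1) :
    ¬ q.Anisotropic := by
  intro han
  have : CharP K 2 := charP_of_injective_ringHom (algebraMap F K).injective 2
  obtain ⟨b, d, u, v, P, P', hP, hP', hq⟩ := exists_albertMat halb hrep han
  have hani : Aniso (albertMat d (tauMat b d u v)) := by
    intro z hz
    have := han (P.mulVec z) (by rw [quadraticForm_apply, hq, hz])
    rw [← Matrix.one_mulVec z, ← hP, ← Matrix.mulVec_mulVec, this, Matrix.mulVec_zero]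
  obtain ⟨hu, hv⟩ := ne_zero_of_aniso_albertMat hani
  obtain ⟨p, s, hp, hs, hK, hx⟩ := exists_functionField_coordinates hP hP' hq hu K
  obtain ⟨g, y, hg, hy, hy0, hgy⟩ :=
    exists_orthogonal_of_equivalent (baseChangeFin_apply q K) hdecomp h1
  have hPK : P.map (algebraMap F K) * P'.map (algebraMap F K) = 1 := by
    rw [← Matrix.map_mul, hP', Matrix.map_one _ (map_zero _) (map_one _)]
  have hqK : ∀ z, qf ((albertMat d (tauMat b d u v)).map (algebraMap F K))
      ((P'.map (algebraMap F K)).mulVec z) = qf ((formMat q).map (algebraMap F K)) z := by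
    intro z
    rw [← qf_map_mulVec hq, Matrix.mulVec_mulVec, hPK, Matrix.one_mulVec]
  have hblK : ∀ z w, bl ((albertMat d (tauMat b d u v)).map (algebraMap F K))
      ((P'.map (algebraMap F K)).mulVec z) ((P'.map (algebraMap F K)).mulVec w) =
        bl ((formMat q).map (algebraMap F K)) z w := by
    intro z w
    have h := hqK (z + w)
    rw [Matrix.mulVec_add, qf_add, qf_add, hqK, hqK] at h
    exact add_left_cancel h
  obtain ⟨h, hh, hhz⟩ := exists_orthogonal_of_isotropic
    (c := (albertMat d (tauMat b d u v)).map (algebraMap F K))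
    (y := (P'.map (algebraMap F K)).mulVec y) (z := Sum.elim ![s, s * p 0] (p ∘ Fin.succ))
    (s := (P'.map (algebraMap F K)).mulVec g)
    (by
      rw [albertMat_map, tauMat_map]
      exact exists_bl_albertMat_ne_zero (by simpa) (by simpa))
    (by rw [hqK, hy])
    (by
      rw [albertMat_map, qf_albertMat, Sum.elim_comp_inr, hx]
      simp only [Sum.elim_inl, Matrix.cons_val_zero, Matrix.cons_val_one]
      linear_combination (s ^ 2 * (1 + p 0 + algebraMap F K d * p 0 ^ 2)) *
        (CharTwo.two_eq_zero : (2 : K) = 0))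
    (fun h0 => hy0 (by
      rw [← Matrix.one_mulVec y, ← hPK, ← Matrix.mulVec_mulVec, h0, Matrix.mulVec_zero]))
    (fun h0 => hs (by simpa using congrFun h0 (.inl 0)))
    (by rw [hqK, hg]) (by rw [hblK, hgy])
  exact bl_ne_zero_of_qf_eq_one hani hp hs hK hx hh hhz

end Char2Quadrics
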